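/- arXiv:1507.04901 — 15 statements merged into one kernel-verified Lean document; each statement's English description precedes it below -/
import Mathlib

section
/- For every finite simple graph G, the 2-rainbow domination number is at most twice the weak Roman domination number: γ_{r2}(G) ≤ 2·γ_r(G). -/
open Finset

section Defs

variable {V : Type*} [Fintype V] [DecidableEq V]

/-- A 2-rainbow dominating function: every vertex assigned `∅` sees both colors
in its neighborhood. -/
def IsRDF (G : SimpleGraph V) (f : V → Finset (Fin 2)) : Prop :=
  ∀ u, f u = ∅ → ∀ c : Fin 2, ∃ v, G.Adj u v ∧ c ∈ f v

/-- The weight of a 2-rainbow dominating function. -/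
def rdfWeight (f : V → Finset (Fin 2)) : ℕ := ∑ u, (f u).card

/-- The 2-rainbow domination number `γ_{r2}`. -/
noncomputable def gammaR2 (G : SimpleGraph V) : ℕ :=
  sInf {w | ∃ f, IsRDF G f ∧ rdfWeight f = w}

/-- A dominating set: every vertex outside has a neighbor inside. -/
def IsDominatingSet (G : SimpleGraph V) (D : Set V) : Prop :=
  ∀ u, u ∉ D → ∃ v ∈ D, G.Adj u v

/-- A weak Roman dominating function: `g : V → {0,1,2}` such that every vertex `u`
with `g u = 0` has a neighbor `v` with `g v ≥ 1` for which the set of vertices with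
positive value under `g_{v→u}` is dominating. -/
def IsWRDF (G : SimpleGraph V) (g : V → ℕ) : Prop :=
  (∀ x, g x ≤ 2) ∧
  ∀ u, g u = 0 → ∃ v, G.Adj u v ∧ 1 ≤ g v ∧
    IsDominatingSet G {x | 1 ≤ (if x = u then g u + 1 else if x = v then g v - 1 else g x)}

/-- The weight of a weak Roman dominating function. -/
def wrdfWeight (g : V → ℕ) : ℕ := ∑ u, g u

/-- The weak Roman domination number `γ_r`. -/
noncomputable def gammaR (G : SimpleGraph V) : ℕ :=
  sInf {w | ∃ g, IsWRDF G g ∧ wrdfWeight g = w}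

end Defs


/-- For every finite simple graph, the 2-rainbow domination number is at most
twice the weak Roman domination number. -/
theorem rainbow_le_two_weakRoman {V : Type*} [Fintype V] [DecidableEq V]
    (G : SimpleGraph V) : gammaR2 G ≤ 2 * gammaR G := by
  have hne : {w | ∃ g, IsWRDF G g ∧ wrdfWeight g = w}.Nonempty :=
    ⟨_, fun _ => 2, ⟨fun _ => le_rfl, fun u hu => by simp at hu⟩, rfl⟩
  obtain ⟨g, hg, hw⟩ := Nat.sInf_mem hne
  have hw' : wrdfWeight g = gammaR G := hw
  rw [← hw']
  refine le_trans (Nat.sInf_le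
    ⟨fun v => if g v = 0 then ∅ else Finset.univ, ?_, rfl⟩) ?_
  · intro u hu c
    have hu0 : g u = 0 := by
      by_contra h
      simp only [h, if_false] at hu
      exact Finset.univ_nonempty.ne_empty hu
    obtain ⟨v, hv, h1, _⟩ := hg.2 u hu0
    refine ⟨v, hv, ?_⟩
    have : g v ≠ 0 := by omega
    simp [this]
  · unfold rdfWeight wrdfWeight
    rw [Finset.mul_sum]
    refine Finset.sum_le_sum fun v _ => ?_
    by_cases h : g v = 0
    · simp [h]
    · simp [h]
      omega
end

section
/- If G is a finite simple graph with γ_{r2}(G) = 2·γ_r(G) and g is a weak Roman dominating function of G of minimum weight, then there is no vertex x of G with g(x) = 2. -/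
open Finset

/-- If `γ_{r2}(G) = 2 γ_r(G)` and `g` is a minimum weak Roman dominating function,
then no vertex has value 2 under `g`. -/
theorem no_vertex_value_two {V : Type*} [Fintype V] [DecidableEq V]
    (G : SimpleGraph V) (g : V → ℕ)
    (heq : gammaR2 G = 2 * gammaR G)
    (hg : IsWRDF G g) (hmin : wrdfWeight g = gammaR G) :
    ∀ x : V, g x ≠ 2 := by
  intro x hx
  have hRDF : IsRDF G (fun u => if g u = 0 then ∅ else Finset.univ) := by
    intro u hu c
    have hu0 : g u = 0 := by
      by_contra h
      simp only [h, if_false] at hu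
      exact Finset.univ_nonempty.ne_empty hu
    obtain ⟨v, hadj, hv, -⟩ := hg.2 u hu0
    refine ⟨v, hadj, ?_⟩
    have : g v ≠ 0 := by omega
    simp [this]
  have hle : gammaR2 G ≤ rdfWeight (fun u => if g u = 0 then ∅ else Finset.univ) :=
    Nat.sInf_le ⟨_, hRDF, rfl⟩
  have hlt : rdfWeight (fun u => if g u = 0 then ∅ else Finset.univ) < 2 * wrdfWeight g := by
    unfold rdfWeight wrdfWeight
    rw [Finset.mul_sum]
    apply Finset.sum_lt_sum
    · intro u _
      by_cases h : g u = 0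
      · simp [h]
      · simp only [h, if_false, Finset.card_univ, Fintype.card_fin]
        omega
    · exact ⟨x, Finset.mem_univ x, by simp [hx]⟩
  omega
end

section
/- Let G be a finite simple graph with γ_{r2}(G) = 2·γ_r(G), let g be a weak Roman dominating function of G of minimum weight, and let V_1 be the set of vertices x with g(x)=1. Then for every vertex v ∈ V_1, the set P_v = { u ∈ V(G)∖V_1 : N(u) ∩ V_1 = {v} } is non-empty and is a clique of G. -/
open Finset

/-- If `γ_{r2}(G) = 2 γ_r(G)` and `g` is a minimum weak Roman dominating function
with `V₁ = {x | g x = 1}`, then for every `v ∈ V₁` the set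
`P_v = {u ∉ V₁ | N(u) ∩ V₁ = {v}}` is nonempty and a clique. -/
theorem Pv_nonempty_clique {V : Type*} [Fintype V] [DecidableEq V]
    (G : SimpleGraph V) (g : V → ℕ)
    (heq : gammaR2 G = 2 * gammaR G)
    (hg : IsWRDF G g) (hmin : wrdfWeight g = gammaR G)
    (v : V) (hv : g v = 1) :
    ({u : V | g u ≠ 1 ∧ G.neighborSet u ∩ {x : V | g x = 1} = {v}} : Set V).Nonempty ∧
    G.IsClique {u : V | g u ≠ 1 ∧ G.neighborSet u ∩ {x : V | g x = 1} = {v}} := by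
  have key : ∀ f : V → Finset (Fin 2), IsRDF G f → 2 * ∑ x, g x ≤ ∑ x, (f x).card := by
    intro f hf
    have h1 : gammaR2 G ≤ rdfWeight f := Nat.sInf_le ⟨f, hf, rfl⟩
    rw [heq, ← hmin] at h1
    exact h1
  have hle : ∀ x, g x ≤ 1 := by
    by_contra hcon
    push Not at hcon
    obtain ⟨a, ha⟩ := hcon
    have h1 := key (fun x => if g x = 0 then ∅ else Finset.univ) (by
      intro u hu c
      have hu0 : g u = 0 := by
        by_contra h
        simp [h] at hu
        exact Finset.univ_nonempty.ne_empty hu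
      obtain ⟨w, hw, hw1, -⟩ := hg.2 u hu0
      refine ⟨w, hw, ?_⟩
      have : g w ≠ 0 := by omega
      simp [this])
    have h2 : ∑ x, (if g x = 0 then (∅ : Finset (Fin 2)) else Finset.univ).card
        < ∑ x, 2 * g x := by
      apply Finset.sum_lt_sum
      · intro x _
        split_ifs with h
        · simp
        · simp; omega
      · refine ⟨a, Finset.mem_univ _, ?_⟩
        have : g a ≠ 0 := by omega
        simp [this]; omega
    rw [← Finset.mul_sum] at h2
    omega
  constructor
  · by_contra hne
    rw [Set.not_nonempty_iff_eq_empty] at hne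
    have h1 := key (fun x => if g x = 0 then ∅ else if x = v then {0} else Finset.univ) (by
      intro u hu c
      have hu0 : g u = 0 := by
        by_contra h
        by_cases h' : u = v
        · simp [h, h'] at hu
          omega
        · simp [h, h'] at hu
          exact Finset.univ_nonempty.ne_empty hu
      obtain ⟨w, hw, hw1, -⟩ := hg.2 u hu0
      have hex : ∃ y, G.Adj u y ∧ g y = 1 ∧ y ≠ v := by
        by_contra hno
        push Not at hno
        have hwv : w = v := hno w hw (le_antisymm (hle w) hw1)
        have hmem : u ∈ ({u : V | g u ≠ 1 ∧
            G.neighborSet u ∩ {x : V | g x = 1} = {v}} : Set V) := by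
          refine ⟨by omega, ?_⟩
          ext y
          constructor
          · rintro ⟨hy, hy1⟩
            exact hno y hy hy1
          · intro hy
            have hy' : y = v := hy
            subst hy'
            exact ⟨hwv ▸ hw, hv⟩
        rw [hne] at hmem
        exact hmem
      obtain ⟨y, hy, hy1, hyv⟩ := hex
      exact ⟨y, hy, by simp [hy1, hyv]⟩)
    have h2 : ∑ x, (if g x = 0 then (∅ : Finset (Fin 2)) else if x = v then {0}
        else Finset.univ).card < ∑ x, 2 * g x := by
      apply Finset.sum_lt_sum
      · intro x _
        split_ifs with h h'
        · simp
        · simp; omega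
        · simp; omega
      · exact ⟨v, Finset.mem_univ _, by simp [hv]⟩
    rw [← Finset.mul_sum] at h2
    omega
  · rintro u ⟨hu, hNu⟩ w ⟨hw, hNw⟩ huw
    have hu0 : g u = 0 := by have := hle u; omega
    have hw0 : g w = 0 := by have := hle w; omega
    obtain ⟨z, hz, hz1, hdom⟩ := hg.2 u hu0
    have hzv : z = v := by
      have : z ∈ G.neighborSet u ∩ {x : V | g x = 1} := ⟨hz, le_antisymm (hle z) hz1⟩
      rw [hNu] at this
      exact this
    subst hzv
    have hwz : w ≠ z := by
      rintro rfl
      exact hw hv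
    obtain ⟨y, hy, hwy⟩ := hdom w (by simp [huw.symm, hwz, hw0])
    by_cases hyu : y = u
    · subst hyu
      exact hwy.symm
    · exfalso
      simp only [Set.mem_setOf_eq, hyu, if_false] at hy
      by_cases hyz : y = z
      · simp [hyz, hv] at hy
      · simp only [hyz, if_false] at hy
        have : y ∈ G.neighborSet w ∩ {x : V | g x = 1} := ⟨hwy, le_antisymm (hle y) hy⟩
        rw [hNw] at this
        exact hyz this
end

section
/- Let G be a finite simple graph with γ_{r2}(G) = 2·γ_r(G), let g be a weak Roman dominating function of G of minimum weight, let V_1 be the set of vertices x with g(x)=1, and for v ∈ V_1 let P_v = { u ∈ V(G)∖V_1 : N(u) ∩ V_1 = {v} }. Then every vertex u ∈ V(G) ∖ (V_1 ∪ ⋃_{v∈V_1} P_v) has some neighbor v ∈ V_1 such that u is adjacent to every vertex of {v} ∪ P_v. -/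
open Finset

/-- Every vertex outside `V₁ ∪ ⋃_{v ∈ V₁} P_v` has a neighbor `v ∈ V₁` such that it
is adjacent to every vertex of `{v} ∪ P_v`. -/
theorem adjacent_to_some_v_and_Pv {V : Type*} [Fintype V] [DecidableEq V]
    (G : SimpleGraph V) (g : V → ℕ)
    (heq : gammaR2 G = 2 * gammaR G)
    (hg : IsWRDF G g) (hmin : wrdfWeight g = gammaR G)
    (u : V) (hu1 : g u ≠ 1)
    (hu2 : ∀ v : V, G.neighborSet u ∩ {x : V | g x = 1} ≠ {v}) :
    ∃ v : V, g v = 1 ∧ G.Adj u v ∧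
      ∀ w : V, g w ≠ 1 → G.neighborSet w ∩ {x : V | g x = 1} = {v} → G.Adj u w := by
  have hdom : IsRDF G (fun x => if 1 ≤ g x then (Finset.univ : Finset (Fin 2)) else ∅) := by
    intro x hx c
    have hx0 : g x = 0 := by
      by_contra h
      have h1 : 1 ≤ g x := by omega
      simp only [h1, if_true] at hx
      exact Finset.univ_nonempty.ne_empty hx
    obtain ⟨v, hv, hv1, -⟩ := hg.2 x hx0
    exact ⟨v, hv, by simp [hv1]⟩
  have hle : gammaR2 G ≤ rdfWeight (fun x => if 1 ≤ g x then (Finset.univ : Finset (Fin 2)) else ∅) :=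
    Nat.sInf_le ⟨_, hdom, rfl⟩
  have hno2 : ∀ x, g x ≤ 1 := by
    by_contra hcon
    push Not at hcon
    obtain ⟨y, hy⟩ := hcon
    have hlt : rdfWeight (fun x => if 1 ≤ g x then (Finset.univ : Finset (Fin 2)) else ∅)
        < ∑ x, 2 * g x := by
      unfold rdfWeight
      apply Finset.sum_lt_sum
      · intro x _
        dsimp only
        split_ifs with h
        · simp; omega
        · simp
      · refine ⟨y, Finset.mem_univ y, ?_⟩
        have h1 : 1 ≤ g y := by omega
        simp [h1]; omega
    rw [← Finset.mul_sum] at hlt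
    unfold wrdfWeight at hmin
    omega
  have hu0 : g u = 0 := by have := hno2 u; omega
  obtain ⟨v, huv, hv1, hD⟩ := hg.2 u hu0
  refine ⟨v, le_antisymm (hno2 v) hv1, huv, ?_⟩
  intro w hw1 hw
  have hwu : w ≠ u := by
    rintro rfl
    exact hu2 v hw
  have hw0 : g w = 0 := by have := hno2 w; omega
  have hv := hno2 v
  obtain ⟨z, hz, hwz⟩ := hD w (by
    simp only [Set.mem_ofPred_eq, hwu, if_false]
    split_ifs <;> omega)
  simp only [Set.mem_ofPred_eq] at hz
  by_cases hzu : z = u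
  · subst hzu
    exact hwz.symm
  · exfalso
    by_cases hzv : z = v
    · subst hzv
      simp only [hzu, if_false, if_true] at hz
      omega
    · simp only [hzu, hzv, if_false] at hz
      have hmem : z ∈ G.neighborSet w ∩ {x : V | g x = 1} :=
        ⟨hwz, le_antisymm (hno2 z) hz⟩
      rw [hw] at hmem
      exact hzv hmem
end

section
/- Let G be a connected finite simple graph containing no induced subgraph isomorphic to K_4 or to K_4 − e. Then γ_{r2}(G) = 2·γ_r(G) if and only if either (i) G is isomorphic to K_2, or (ii) G arises from two vertex-disjoint triangles by adding a matching consisting of exactly two edges between them, or (iii) for k = γ_r(G) the vertex set of G can be partitioned into k triangles v_1w_1u_1, …, v_kw_ku_k such that every edge of G not inside one of these triangles joins two vertices of {v_1,…,v_k}. -/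
open Finset

/-- `K₄` minus one edge. -/
def K4e : SimpleGraph (Fin 4) := (⊤ : SimpleGraph (Fin 4)).deleteEdges {s(0, 1)}

section Helpers

variable {V : Type*} [Fintype V] [DecidableEq V]

lemma gammaR2_le (G : SimpleGraph V) (f : V → Finset (Fin 2)) (hf : IsRDF G f) :
    gammaR2 G ≤ rdfWeight f := Nat.sInf_le ⟨f, hf, rfl⟩

lemma gammaR_le (G : SimpleGraph V) (g : V → ℕ) (hg : IsWRDF G g) :
    gammaR G ≤ wrdfWeight g := Nat.sInf_le ⟨g, hg, rfl⟩

lemma univ2_ne : (Finset.univ : Finset (Fin 2)) ≠ ∅ := by decide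

lemma inj3 (a b c : V) (hab : a ≠ b) (hac : a ≠ c) (hbc : b ≠ c) :
    Function.Injective ![a, b, c] := by
  intro i j h
  fin_cases i <;> fin_cases j <;> simp_all

lemma tri_adj (G : SimpleGraph V) (a b c : V) (hab : G.Adj a b) (hac : G.Adj a c)
    (hbc : G.Adj b c) (i j : Fin 3) (hij : i ≠ j) :
    G.Adj ((![a, b, c] : Fin 3 → V) i) ((![a, b, c] : Fin 3 → V) j) := by
  fin_cases i <;> fin_cases j <;> simp_all [G.adj_comm]

lemma exists_rdf (G : SimpleGraph V) : ∃ f, IsRDF G f ∧ rdfWeight f = gammaR2 G := by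
  have : {w | ∃ f, IsRDF G f ∧ rdfWeight f = w}.Nonempty :=
    ⟨_, fun _ => Finset.univ, fun u h => absurd h univ2_ne, rfl⟩
  exact Nat.sInf_mem this

lemma exists_wrdf (G : SimpleGraph V) : ∃ g, IsWRDF G g ∧ wrdfWeight g = gammaR G := by
  have : {w | ∃ g, IsWRDF G g ∧ wrdfWeight g = w}.Nonempty :=
    ⟨_, fun _ => 1, ⟨by simp, by simp⟩, rfl⟩
  exact Nat.sInf_mem this

lemma isRDF_of_dom (G : SimpleGraph V) (D : Finset V)
    (hD : ∀ u, u ∉ D → ∃ v ∈ D, G.Adj u v) :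
    IsRDF G (fun x => if x ∈ D then Finset.univ else ∅) := by
  intro u hu c
  have : u ∉ D := by
    intro h
    simp only [if_pos h] at hu
    exact univ2_ne hu
  obtain ⟨v, hv, h⟩ := hD u this
  exact ⟨v, h, by simp [hv]⟩

lemma weight_dom (D : Finset V) :
    rdfWeight (fun x => if x ∈ D then (Finset.univ : Finset (Fin 2)) else ∅) = 2 * D.card := by
  unfold rdfWeight
  simp only [apply_ite Finset.card, Finset.card_univ, Fintype.card_fin, Finset.card_empty]
  rw [Finset.sum_ite_mem]
  simp [mul_comm]

lemma wrdf_support_dom (G : SimpleGraph V) (g : V → ℕ) (hg : IsWRDF G g) :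
    ∀ u, u ∉ (Finset.univ.filter fun x => 1 ≤ g x) →
      ∃ v ∈ (Finset.univ.filter fun x => 1 ≤ g x), G.Adj u v := by
  intro u hu
  obtain ⟨v, h1, h2, _⟩ := hg.2 u (by simpa using hu)
  exact ⟨v, by simpa using h2, h1⟩

lemma support_card_le (g : V → ℕ) :
    (Finset.univ.filter fun x => 1 ≤ g x).card ≤ wrdfWeight g := by
  unfold wrdfWeight
  rw [Finset.card_filter]
  apply Finset.sum_le_sum
  intro x _
  split_ifs <;> omega

lemma gammaR2_le_two_mul (G : SimpleGraph V) : gammaR2 G ≤ 2 * gammaR G := by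
  obtain ⟨g, hg, hw⟩ := exists_wrdf G
  have h1 := gammaR2_le G _ (isRDF_of_dom G _ (wrdf_support_dom G g hg))
  rw [weight_dom] at h1
  have h2 := support_card_le g
  omega

/-- Under the freeness hypotheses every edge is in at most one triangle. -/
lemma edge_uniq (G : SimpleGraph V)
    (hK4 : ∀ s : Set V, ¬ Nonempty (G.induce s ≃g (⊤ : SimpleGraph (Fin 4))))
    (hK4e : ∀ s : Set V, ¬ Nonempty (G.induce s ≃g K4e))
    (a b c d : V) (hab : G.Adj a b) (hac : G.Adj a c) (hbc : G.Adj b c)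
    (had : G.Adj a d) (hbd : G.Adj b d) : c = d := by
  by_contra hcd
  have hinj : Function.Injective ![c, d, a, b] := by
    intro i j h
    have := hab.ne; have := hac.ne; have := hbc.ne; have := had.ne; have := hbd.ne
    fin_cases i <;> fin_cases j <;> simp_all
  let e : Fin 4 ≃ Set.range ![c, d, a, b] := Equiv.ofInjective _ hinj
  by_cases h : G.Adj c d
  · apply hK4 (Set.range ![c, d, a, b])
    refine ⟨(⟨e, ?_⟩ : (⊤ : SimpleGraph (Fin 4)) ≃g _).symm⟩
    intro i j
    fin_cases i <;> fin_cases j <;>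
      simp [e, SimpleGraph.comap_adj, h, hab, hac, hbc, had, hbd, h.symm, hab.symm, hac.symm, hbc.symm, had.symm, hbd.symm]
  · apply hK4e (Set.range ![c, d, a, b])
    refine ⟨(⟨e, ?_⟩ : K4e ≃g _).symm⟩
    have h' : ¬ G.Adj d c := fun h' => h h'.symm
    intro i j
    fin_cases i <;> fin_cases j <;>
      simp [e, K4e, SimpleGraph.comap_adj, h, h', hab, hac, hbc, had, hbd, hab.symm, hac.symm, hbc.symm, had.symm, hbd.symm]

lemma closed_eq_univ (G : SimpleGraph V) (hconn : G.Connected) (P : V → Prop) (a : V) (ha : P a)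
    (hP : ∀ x y, P x → G.Adj x y → P y) (z : V) : P z := by
  obtain ⟨w⟩ := hconn.preconnected a z
  induction w with
  | nil => exact ha
  | cons h _ ih => exact ih (hP _ _ ha h)

/-- The saving construction. -/
lemma save (G : SimpleGraph V) {k : ℕ} (β : V → Fin k)
    (hadj : ∀ x y, β x = β y → x ≠ y → G.Adj x y)
    (hle : ∀ f, IsRDF G f → 2 * k ≤ rdfWeight f)
    (r : Fin k → V) (hr : ∀ j, β (r j) = j) (i : Fin k) :
    ∃ x, β x = i ∧ x ≠ r i ∧ ∀ j, j ≠ i → ¬ G.Adj x (r j) := by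
  by_contra hcon
  push Not at hcon
  let f : V → Finset (Fin 2) :=
    fun x => if r (β x) = x then (if β x = i then {0} else Finset.univ) else ∅
  have hf : IsRDF G f := by
    intro u hu c
    have hne : r (β u) ≠ u := by
      intro h
      simp only [f, h, if_true] at hu
      split_ifs at hu
      · exact absurd hu (by simp)
      · exact univ2_ne hu
    by_cases hi : β u = i
    · obtain ⟨j, hj, h⟩ := hcon u hi (by rw [← hi]; exact hne.symm)
      exact ⟨r j, h, by simp [f, hr, hj]⟩
    · exact ⟨r (β u), hadj _ _ (hr _).symm hne.symm, by simp [f, hr, hi]⟩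
  have h := hle f hf
  have hinj : Function.Injective r := Function.LeftInverse.injective hr
  have hsum : rdfWeight f = ∑ j : Fin k, (f (r j)).card := by
    unfold rdfWeight
    rw [← Finset.sum_image (s := Finset.univ) (g := r) (f := fun x => (f x).card)
      (fun _ _ _ _ h => hinj h)]
    symm
    apply Finset.sum_subset (Finset.subset_univ _)
    intro x _ hx
    have : r (β x) ≠ x := fun h => hx (by rw [← h]; simp)
    simp [f, this]
  have hlt : ∑ j : Fin k, (f (r j)).card < ∑ j : Fin k, 2 := by
    apply Finset.sum_lt_sum
    · intro j _
      exact (Finset.card_le_univ _).trans (by simp)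
    · exact ⟨i, Finset.mem_univ _, by simp [f, hr]⟩
  simp at hlt
  omega

lemma abstract_K2 (G : SimpleGraph V) (hconn : G.Connected) {k : ℕ} (β : V → Fin k)
    (hadj : ∀ x y, β x = β y → x ≠ y → G.Adj x y)
    (hsurj : ∀ i, ∃ x, β x = i)
    (hle : ∀ f, IsRDF G f → 2 * k ≤ rdfWeight f)
    (v p : V) (hvp : v ≠ p) (hb : β v = β p) (hall : ∀ x, β x = β v → x = v ∨ x = p) :
    Nonempty (G ≃g (⊤ : SimpleGraph (Fin 2))) := by
  choose r0 hr0 using hsurj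
  have key : ∀ v p : V, v ≠ p → β v = β p → (∀ x, β x = β v → x = v ∨ x = p) →
      ∀ u, G.Adj v u → β u = β v := by
    intro v p hvp hb hall u hu
    by_contra hne
    obtain ⟨x, h1, h2, h3⟩ := save G β hadj hle
      (Function.update (Function.update r0 (β u) u) (β v) p) (by
        intro j
        by_cases hj : j = β v
        · subst hj; simp [hb]
        · by_cases hj2 : j = β u
          · subst hj2; simp [hj]
          · simp [hj, hj2, hr0]) (β v)
    simp at h2
    have h4 := h3 (β u) hne
    rw [Function.update_of_ne hne, Function.update_self] at h4
    rcases hall x h1 with rfl | rfl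
    · exact h4 hu
    · exact h2 rfl
  have hV : ∀ z, β z = β v := by
    apply closed_eq_univ G hconn (fun z => β z = β v) v rfl
    intro x y hx hxy
    rcases hall x hx with rfl | rfl
    · exact key _ p hvp hb hall y hxy
    · rw [key x v hvp.symm hb.symm (fun z hz => (hall z (hz.trans hb.symm)).symm) y hxy, hb]
  have hG : ∀ x y, G.Adj x y ↔ x ≠ y :=
    fun x y => ⟨fun h => h.ne, fun h => hadj x y ((hV x).trans (hV y).symm) h⟩
  have hcard : Fintype.card V = 2 := by
    have : (Finset.univ : Finset V) = {v, p} := by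
      ext x; simpa using hall x (hV x)
    rw [← Finset.card_univ, this, Finset.card_pair hvp]
  refine ⟨⟨Fintype.equivFinOfCardEq hcard, ?_⟩⟩
  intro a b
  simp [hG]

lemma abstract_case (G : SimpleGraph V) (hconn : G.Connected)
    (uniq : ∀ a b c d : V, G.Adj a b → G.Adj a c → G.Adj b c → G.Adj a d → G.Adj b d → c = d)
    {k : ℕ} (β : V → Fin k)
    (hadj : ∀ x y, β x = β y → x ≠ y → G.Adj x y)
    (h2 : ∀ i, ∃ x y, x ≠ y ∧ β x = i ∧ β y = i)
    (hle : ∀ f, IsRDF G f → 2 * k ≤ rdfWeight f) :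
      (Nonempty (G ≃g (⊤ : SimpleGraph (Fin 2)))) ∨
      (∃ x y : Fin 3 → V,
        Function.Injective (Sum.elim x y) ∧
        (∀ z : V, ∃ i, z = x i ∨ z = y i) ∧
        (∀ a b : V, G.Adj a b ↔
          ((∃ i j, i ≠ j ∧ a = x i ∧ b = x j) ∨
           (∃ i j, i ≠ j ∧ a = y i ∧ b = y j) ∨
           (∃ i : Fin 3, i ≠ 2 ∧ ((a = x i ∧ b = y i) ∨ (a = y i ∧ b = x i)))))) ∨
      (∃ v w u : Fin k → V,
        Function.Injective (Sum.elim v (Sum.elim w u)) ∧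
        (∀ z : V, ∃ i, z = v i ∨ z = w i ∨ z = u i) ∧
        (∀ i, G.Adj (v i) (w i) ∧ G.Adj (v i) (u i) ∧ G.Adj (w i) (u i)) ∧
        (∀ a b : V, G.Adj a b →
          (∃ i, ({a, b} : Set V) ⊆ {v i, w i, u i}) ∨ (∃ i j, a = v i ∧ b = v j))) := by
  have hsurj : ∀ i, ∃ x, β x = i := fun i => by
    obtain ⟨x, y, _, h, _⟩ := h2 i
    exact ⟨x, h⟩
  by_cases hA : ∃ v p, v ≠ p ∧ β v = β p ∧ (∀ x, β x = β v → x = v ∨ x = p)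
  · obtain ⟨v, p, e1, e2, e3⟩ := hA
    exact Or.inl (abstract_K2 G hconn β hadj hsurj hle v p e1 e2 e3)
  right
  push Not at hA
  -- any two distinct vertices of a block extend to the whole block
  have third : ∀ v p, v ≠ p → β v = β p → ∃ q, q ≠ v ∧ q ≠ p ∧ β q = β v ∧
      ∀ x, β x = β v → x = v ∨ x = p ∨ x = q := by
    intro v p hvp hb
    obtain ⟨q, hq, hqv, hqp⟩ := hA v p hvp hb
    refine ⟨q, hqv, hqp, hq, ?_⟩
    intro x hx
    by_contra hcon
    push Not at hcon
    obtain ⟨c1, c2, c3⟩ := hcon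
    exact c3 (uniq v p x q (hadj _ _ hb hvp) (hadj _ _ hx.symm c1.symm)
      (hadj _ _ (hb.symm.trans hx.symm) c2.symm) (hadj _ _ hq.symm hqv.symm)
      (hadj _ _ (hb.symm.trans hq.symm) hqp.symm))
  by_cases hB : ∀ i, ∃ v, β v = i ∧ ∀ x, β x = i → x ≠ v → ∀ y, G.Adj x y → β y = i
  · right
    choose v hv hvc using hB
    have hex : ∀ i, ∃ w, w ≠ v i ∧ β w = i := by
      intro i
      obtain ⟨x, y, hxy, hx, hy⟩ := h2 i
      by_cases h : x = v i
      · exact ⟨y, by rw [← h]; exact hxy.symm, hy⟩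
      · exact ⟨x, h, hx⟩
    choose w hwv hw using hex
    choose u huv huw hu hall using fun i => third (v i) (w i) (hwv i).symm ((hv i).trans (hw i).symm)
    have hu' : ∀ i, β (u i) = i := fun i => (hu i).trans (hv i)
    refine ⟨v, w, u, ?_, ?_, ?_, ?_⟩
    · have aux : ∀ {p q : Fin k → V} (hp : ∀ i, β (p i) = i) (hq : ∀ i, β (q i) = i) {i j},
          p i = q j → i = j := by
        intro p q hp hq i j h
        rw [← hp i, h, hq]
      rintro (i | i | i) (j | j | j) h <;> simp only [Sum.elim_inl, Sum.elim_inr] at h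
      · rw [aux hv hv h]
      · have := aux hv hw h; subst this; exact absurd h.symm (hwv _)
      · have := aux hv hu' h; subst this; exact absurd h.symm (huv _)
      · have := aux hw hv h; subst this; exact absurd h (hwv _)
      · rw [aux hw hw h]
      · have := aux hw hu' h; subst this; exact absurd h.symm (huw _)
      · have := aux hu' hv h; subst this; exact absurd h (huv _)
      · have := aux hu' hw h; subst this; exact absurd h (huw _)
      · rw [aux hu' hu' h]
    · intro z
      exact ⟨β z, hall (β z) z (hv _).symm⟩
    · intro i
      exact ⟨hadj _ _ ((hv i).trans (hw i).symm) (hwv i).symm,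
        hadj _ _ (hu i).symm (huv i).symm, hadj _ _ ((hw i).trans (hu' i).symm) (huw i).symm⟩
    · intro a b hab
      by_cases h : β a = β b
      · left
        refine ⟨β a, ?_⟩
        intro x hx
        rcases hx with rfl | rfl
        · exact hall _ _ (hv _).symm
        · exact hall _ _ (by rw [hv, h])
      · right
        refine ⟨β a, β b, ?_, ?_⟩
        · by_contra hc
          exact h (hvc (β a) a rfl hc b hab).symm
        · by_contra hc
          exact h (hvc (β b) b rfl hc a hab.symm)
  left
  push Not at hB
  obtain ⟨i, hi⟩ := hB
  obtain ⟨v0, hv0⟩ := hsurj i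
  obtain ⟨a, ha, -, x, hax, hxi⟩ := hi v0 hv0
  obtain ⟨b, hb, hba, y, hby, hyi⟩ := hi a ha
  have lemC : ∀ a b x y, a ≠ b → β a = β b → G.Adj a x → G.Adj b y → β x ≠ β a → β y ≠ β b →
      β x = β y := by
    intro a b x y hab hb hx hy hxa hyb
    by_contra hne
    obtain ⟨c, hca, hcb, hc, hall⟩ := third a b hab hb
    choose r0 hr0 using hsurj
    have hya : β y ≠ β a := by rwa [hb]
    obtain ⟨z, z1, z2, z3⟩ := save G β hadj hle
      (Function.update (Function.update (Function.update r0 (β y) y) (β x) x) (β a) c) (by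
        intro j
        by_cases hj : j = β a
        · subst hj; simp [hc]
        · by_cases hj2 : j = β x
          · subst hj2; simp [hj]
          · by_cases hj3 : j = β y
            · subst hj3; simp [hj, hj2]
            · simp [hj, hj2, hj3, hr0]) (β a)
    simp at z2
    have z4 := z3 (β x) hxa
    have z5 := z3 (β y) hya
    rw [Function.update_of_ne hxa, Function.update_self] at z4
    rw [Function.update_of_ne hya, Function.update_of_ne (Ne.symm hne), Function.update_self] at z5
    rcases hall z z1 with rfl | rfl | rfl
    · exact z4 hx
    · exact z5 hy
    · exact z2 rfl
  -- a vertex has at most one neighbour in another block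
  have one : ∀ s x y, G.Adj s x → G.Adj s y → β x = β y → β s ≠ β x → x = y := by
    intro s x y hx hy hxy hs
    by_contra hne
    obtain ⟨z, hzx, hzy, hz, -⟩ := third x y hne hxy
    have := uniq x y z s (hadj _ _ hxy hne) (hadj _ _ hz.symm hzx.symm)
      (hadj _ _ (hxy.symm.trans hz.symm) hzy.symm) hx.symm hy.symm
    exact hs (by rw [← this, hz])
  have hab : β a = β b := ha.trans hb.symm
  have hxy : β x = β y := lemC a b x y hba.symm hab hax hby (by rwa [ha]) (by rwa [hb])
  have hxney : x ≠ y := by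
    rintro rfl
    exact hba (one x b a hby.symm hax.symm hab.symm (by rwa [hb]))
  have hxa : β x ≠ β a := by rwa [ha]
  have hya : β y ≠ β a := by rwa [ha]
  have out1 : ∀ s t, β s = β a → G.Adj s t → β t = β a ∨ β t = β x := by
    intro s t hs hst
    by_cases ht : β t = β a
    · exact Or.inl ht
    right
    by_cases hsa : s = a
    · subst hsa
      rw [lemC s b t y hba.symm hab hst hby ht (by rwa [← hab]), hxy]
    · exact lemC s a t x hsa hs hst hax (by rwa [hs]) hxa
  have out2 : ∀ s t, β s = β x → G.Adj s t → β t = β a ∨ β t = β x := by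
    intro s t hs hst
    by_cases ht : β t = β x
    · exact Or.inr ht
    left
    by_cases hsa : s = x
    · subst hsa
      rw [lemC s y t b hxney hxy hst hby.symm ht (by rw [← hab]; exact hya.symm), hab]
    · exact lemC s x t a hsa hs hst hax.symm (by rwa [hs]) hxa.symm
  have hV : ∀ z, β z = β a ∨ β z = β x := by
    apply closed_eq_univ G hconn (fun z => β z = β a ∨ β z = β x) a (Or.inl rfl)
    rintro s t (hs | hs) hst
    · exact out1 s t hs hst
    · exact out2 s t hs hst
  obtain ⟨c, hca, hcb, hc, hallc⟩ := third a b hba.symm hab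
  obtain ⟨z, hzx, hzy, hz, hallz⟩ := third x y hxney hxy
  have cross : ∀ s t, β s = β a → β t = β x → s ≠ t := by
    rintro s t hs ht rfl
    exact hxa (ht.symm.trans hs)
  have hcz : ¬ G.Adj c z := by
    intro hcz
    let f : V → Finset (Fin 2) :=
      fun t => if t = a then {0} else if t = c then {0} else if t = y then {1} else ∅
    have hyc : y ≠ c := (cross _ _ hc hxy.symm).symm
    have hya' : y ≠ a := (cross _ _ rfl hxy.symm).symm
    have hbyy : β y = β x := hxy.symm
    have hf : IsRDF G f := by
      have base : ∀ t s, (G.Adj t s ∧ 0 ∈ f s) → (∃ s', G.Adj t s' ∧ 1 ∈ f s') →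
          ∀ cc : Fin 2, ∃ v, G.Adj t v ∧ cc ∈ f v := by
        intro t s h1 h2 cc
        fin_cases cc
        · exact ⟨s, h1⟩
        · exact h2
      have fa : (0 : Fin 2) ∈ f a := by simp [f]
      have fc : (0 : Fin 2) ∈ f c := by simp [f, hca]
      have fy : (1 : Fin 2) ∈ f y := by simp [f, hya', hyc]
      intro t ht
      have hta : t ≠ a := by rintro rfl; rw [ht] at fa; simp at fa
      have htc : t ≠ c := by rintro rfl; rw [ht] at fc; simp at fc
      have hty : t ≠ y := by rintro rfl; rw [ht] at fy; simp at fy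
      rcases hV t with h | h
      · rcases hallc t h with rfl | rfl | rfl
        · exact absurd rfl hta
        · exact base _ a ⟨hadj _ _ hab.symm hba, fa⟩ ⟨y, hby, fy⟩
        · exact absurd rfl htc
      · rcases hallz t h with rfl | rfl | rfl
        · exact base _ a ⟨hax.symm, fa⟩ ⟨y, hadj _ _ hxy hxney, fy⟩
        · exact absurd rfl hty
        · exact base _ c ⟨hcz.symm, fc⟩ ⟨y, hadj _ _ (hz.trans hxy) hzy, fy⟩
    have h1 := hle f hf
    have h3 : rdfWeight f = 3 := by
      unfold rdfWeight
      rw [← Finset.sum_subset (Finset.subset_univ {a, c, y})]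
      · rw [Finset.sum_insert (by simp [hca.symm, hya'.symm]), Finset.sum_pair hyc.symm]
        simp [f, hca, hya', hyc]
      · intro t _ ht
        simp at ht
        simp [f, ht]
    have h4 : 1 < k := by
      have := Fintype.one_lt_card_iff.mpr ⟨β x, β a, hxa⟩
      simpa using this
    omega
  refine ⟨![a, b, c], ![x, y, z], ?_, ?_, ?_⟩
  · have hb' : β b = β a := hab.symm
    have hy' : β y = β x := hxy.symm
    have c1 := cross a x rfl rfl
    have c2 := cross a y rfl hy'
    have c3 := cross a z rfl hz
    have c4 := cross b x hb' rfl
    have c5 := cross b y hb' hy'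
    have c6 := cross b z hb' hz
    have c7 := cross c x hc rfl
    have c8 := cross c y hc hy'
    have c9 := cross c z hc hz
    rw [Sum.elim_injective]
    refine ⟨?_, ?_, ?_⟩
    · exact inj3 a b c hba.symm hca.symm hcb.symm
    · exact inj3 x y z hxney hzx.symm hzy.symm
    · intro i j
      fin_cases i <;> fin_cases j <;> assumption
  · intro t
    rcases hV t with h | h
    · rcases hallc t h with rfl | rfl | rfl
      · exact ⟨0, by simp⟩
      · exact ⟨1, by simp⟩
      · exact ⟨2, by simp⟩
    · rcases hallz t h with rfl | rfl | rfl
      · exact ⟨0, by simp⟩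
      · exact ⟨1, by simp⟩
      · exact ⟨2, by simp⟩
  · have crossE : ∀ s t, β s = β a → β t = β x → (G.Adj s t ↔ (s = a ∧ t = x) ∨ (s = b ∧ t = y)) := by
      intro s t hs ht
      constructor
      · intro hst
        have hst' : β s ≠ β x := by rw [hs]; exact hxa.symm
        rcases hallc s hs with rfl | rfl | rfl
        · exact Or.inl ⟨rfl, one s t x hst hax ht (by rwa [ht])⟩
        · exact Or.inr ⟨rfl, one s t y hst hby (ht.trans hxy) (by rwa [ht])⟩
        · exfalso
          have hts : β t ≠ β s := by rw [ht, hs]; exact hxa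
          rcases hallz t ht with rfl | rfl | rfl
          · exact hca (one t s a hst.symm hax.symm hs hts)
          · exact hcb (one t s b hst.symm hby.symm (hs.trans hab) hts)
          · exact hcz hst
      · rintro (⟨rfl, rfl⟩ | ⟨rfl, rfl⟩)
        · exact hax
        · exact hby
    have inA : ∀ s, β s = β a ↔ ∃ i, s = (![a, b, c] : Fin 3 → V) i := by
      intro s
      constructor
      · intro h
        rcases hallc s h with rfl | rfl | rfl
        · exact ⟨0, by simp⟩
        · exact ⟨1, by simp⟩
        · exact ⟨2, by simp⟩
      · rintro ⟨i, rfl⟩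
        fin_cases i <;> simp [hab, hc]
    have inX : ∀ s, β s = β x ↔ ∃ i, s = (![x, y, z] : Fin 3 → V) i := by
      intro s
      constructor
      · intro h
        rcases hallz s h with rfl | rfl | rfl
        · exact ⟨0, by simp⟩
        · exact ⟨1, by simp⟩
        · exact ⟨2, by simp⟩
      · rintro ⟨i, rfl⟩
        fin_cases i <;> simp [hxy, hz]
    intro s t
    constructor
    · intro hst
      rcases hV s with hs | hs <;> rcases hV t with ht | ht
      · left
        obtain ⟨i, rfl⟩ := (inA s).1 hs
        obtain ⟨j, rfl⟩ := (inA t).1 ht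
        exact ⟨i, j, by rintro rfl; exact hst.ne rfl, rfl, rfl⟩
      · right; right
        rcases (crossE s t hs ht).1 hst with ⟨rfl, rfl⟩ | ⟨rfl, rfl⟩
        · exact ⟨0, by decide, by simp⟩
        · exact ⟨1, by decide, by simp⟩
      · right; right
        rcases (crossE t s ht hs).1 hst.symm with ⟨rfl, rfl⟩ | ⟨rfl, rfl⟩
        · exact ⟨0, by decide, by simp⟩
        · exact ⟨1, by decide, by simp⟩
      · right; left
        obtain ⟨i, rfl⟩ := (inX s).1 hs
        obtain ⟨j, rfl⟩ := (inX t).1 ht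
        exact ⟨i, j, by rintro rfl; exact hst.ne rfl, rfl, rfl⟩
    · have hb' : β b = β a := hab.symm
      have e1 := hadj a b hab hba.symm
      have e2 := hadj a c hc.symm hca.symm
      have e3 := hadj b c (hb'.trans hc.symm) hcb.symm
      have e4 := hadj x y hxy hxney
      have e5 := hadj x z hz.symm hzx.symm
      have e6 := hadj y z (hxy.symm.trans hz.symm) hzy.symm
      rintro (⟨i, j, hij, rfl, rfl⟩ | ⟨i, j, hij, rfl, rfl⟩ | ⟨i, hi, ⟨rfl, rfl⟩ | ⟨rfl, rfl⟩⟩)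
      · exact tri_adj G a b c e1 e2 e3 i j hij
      · exact tri_adj G x y z e4 e5 e6 i j hij
      · fin_cases i
        · exact hax
        · exact hby
        · exact absurd rfl hi
      · fin_cases i
        · exact hax.symm
        · exact hby.symm
        · exact absurd rfl hi

/-- From an optimal weak Roman dominating function we get the block partition. -/
lemma exists_blocks (G : SimpleGraph V)
    (uniq : ∀ a b c d : V, G.Adj a b → G.Adj a c → G.Adj b c → G.Adj a d → G.Adj b d → c = d)
    (heq : gammaR2 G = 2 * gammaR G) :
    ∃ β : V → Fin (gammaR G), (∀ x y, β x = β y → x ≠ y → G.Adj x y) ∧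
      (∀ i, ∃ x y, x ≠ y ∧ β x = i ∧ β y = i) := by
  obtain ⟨g, hg, hw⟩ := exists_wrdf G
  set D := Finset.univ.filter fun x => 1 ≤ g x with hDdef
  have hdom := wrdf_support_dom G g hg
  rw [← hDdef] at hdom
  have hcardle : D.card ≤ gammaR G := hw ▸ support_card_le g
  have hcard : D.card = gammaR G := by
    have h1 := gammaR2_le G _ (isRDF_of_dom G D hdom)
    rw [weight_dom] at h1
    omega
  have hmem : ∀ x, x ∈ D ↔ 1 ≤ g x := by intro x; simp [hDdef]
  have hg1 : ∀ x, g x ≤ 1 := by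
    by_contra hcon
    push Not at hcon
    obtain ⟨x, hx⟩ := hcon
    have : D.card < wrdfWeight g := by
      unfold wrdfWeight
      rw [hDdef, Finset.card_filter]
      apply Finset.sum_lt_sum
      · intro y _
        split_ifs <;> omega
      · exact ⟨x, Finset.mem_univ _, by split_ifs <;> omega⟩
    omega
  -- each vertex of D has a private neighbour
  have priv : ∀ v ∈ D, ∃ p, p ∉ D ∧ G.Adj p v ∧ ∀ w ∈ D, G.Adj p w → w = v := by
    intro v hv
    by_contra hcon
    push Not at hcon
    let f : V → Finset (Fin 2) := fun x => if x = v then {0} else if x ∈ D then Finset.univ else ∅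
    have hf : IsRDF G f := by
      intro u hu cc
      have huv : u ≠ v := by
        rintro rfl; simp [f] at hu
      have huD : u ∉ D := by
        intro h; simp [f, huv, h] at hu; exact univ2_ne hu
      obtain ⟨w, hwD, huw⟩ := hdom u huD
      by_cases hwv : w = v
      · subst hwv
        obtain ⟨w', h1, h2, h3⟩ := hcon u huD huw
        exact ⟨w', h2, by simp [f, h1, h3]⟩
      · exact ⟨w, huw, by simp [f, hwD, hwv]⟩
    have h1 := gammaR2_le G f hf
    have h2 : rdfWeight f < 2 * D.card := by
      rw [← weight_dom]
      unfold rdfWeight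
      apply Finset.sum_lt_sum
      · intro x _
        apply Finset.card_le_card
        by_cases hx : x = v
        · subst hx; simp [hv]
        · simp [f, hx]
      · exact ⟨v, Finset.mem_univ _, by simp [f, hv]⟩
    omega
  have hdef : ∀ u, u ∉ D → ∃ v ∈ D, G.Adj u v ∧
      ∀ p, p ∉ D → (∀ w ∈ D, G.Adj p w → w = v) → p ≠ u → G.Adj p u := by
    intro u hu
    have hu0 : g u = 0 := by
      rw [hmem] at hu; omega
    obtain ⟨v, huv, hv1, hd⟩ := hg.2 u hu0
    refine ⟨v, (hmem v).2 hv1, huv, ?_⟩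
    intro p hp hpv hpu
    have hgp : g p = 0 := by
      rw [hmem] at hp; omega
    have hpv' : p ≠ v := by rintro rfl; omega
    obtain ⟨t, ht, hpt⟩ := hd p (by simp [hpu, hpv', hgp])
    have ht' : 1 ≤ (if t = u then g u + 1 else if t = v then g v - 1 else g t) := ht
    split_ifs at ht' with h1 h2
    · rwa [← h1]
    · have := hg1 v
      omega
    · exact absurd (hpv t ((hmem t).2 ht') hpt) h2
  have hb : ∀ u, ∃ v : D, (u ∈ D → u = v) ∧ (u ∉ D → G.Adj u v ∧
      ∀ p, p ∉ D → (∀ w ∈ D, G.Adj p w → w = v) → p ≠ u → G.Adj p u) := by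
    intro u
    by_cases hu : u ∈ D
    · exact ⟨⟨u, hu⟩, fun _ => rfl, fun h => absurd hu h⟩
    · obtain ⟨v, hv, h⟩ := hdef u hu
      exact ⟨⟨v, hv⟩, fun h => absurd h hu, fun _ => h⟩
  choose b hb1 hb2 using hb
  have e : D ≃ Fin (gammaR G) := Fintype.equivFinOfCardEq (by simpa using hcard)
  refine ⟨fun x => e (b x), ?_, ?_⟩
  · intro x y hxy hne
    have hxy : b x = b y := e.injective hxy
    by_cases hx : x ∈ D <;> by_cases hy : y ∈ D
    · exact absurd ((hb1 x hx).trans ((congrArg Subtype.val hxy).trans (hb1 y hy).symm)) hne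
    · have := (hb2 y hy).1
      rw [← hxy, ← hb1 x hx] at this
      exact this.symm
    · have := (hb2 x hx).1
      rw [hxy, ← hb1 y hy] at this
      exact this
    · obtain ⟨p, hpD, hpv, hpp⟩ := priv (b x) (b x).2
      obtain ⟨hx1, hx2⟩ := hb2 x hx
      obtain ⟨hy1, hy2⟩ := hb2 y hy
      rw [← hxy] at hy1 hy2
      by_cases h1 : p = x
      · subst h1
        exact hy2 p hpD hpp hne
      · by_cases h2 : p = y
        · subst h2
          exact (hx2 p hpD hpp h1).symm
        · exact absurd (uniq p (b x) x y hpv (hx2 p hpD hpp h1) hx1.symm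
            (hy2 p hpD hpp h2) hy1.symm) hne
  · intro i
    obtain ⟨p, hpD, hpv, hpp⟩ := priv (e.symm i) (e.symm i).2
    refine ⟨e.symm i, p, ?_, ?_, ?_⟩
    · rintro h
      exact hpD (h ▸ (e.symm i).2)
    · have : b (e.symm i) = e.symm i := Subtype.ext (hb1 _ (e.symm i).2).symm
      simp [this]
    · have : b p = e.symm i := Subtype.ext (hpp _ (b p).2 (hb2 p hpD).1)
      simp [this]

lemma card_two_of_cover (s t : Finset (Fin 2)) (h : ∀ c, c ∈ s ∨ c ∈ t) :
    2 ≤ s.card + t.card := by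
  have : (Finset.univ : Finset (Fin 2)) ⊆ s ∪ t := by
    intro c _; simpa using h c
  calc 2 = (Finset.univ : Finset (Fin 2)).card := by simp
    _ ≤ _ := Finset.card_le_card this
    _ ≤ _ := Finset.card_union_le _ _

lemma back_K2 (G : SimpleGraph V) (h : Nonempty (G ≃g (⊤ : SimpleGraph (Fin 2)))) :
    2 * gammaR G ≤ gammaR2 G := by
  obtain ⟨e⟩ := h
  have hA : ∀ x y, G.Adj x y ↔ x ≠ y := by
    intro x y
    rw [← e.map_adj_iff]
    simp
  obtain ⟨a, ha⟩ := e.surjective 0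
  obtain ⟨b, hb⟩ := e.surjective 1
  have hab : a ≠ b := by rintro rfl; rw [ha] at hb; simp at hb
  have hall : ∀ x, x = a ∨ x = b := by
    intro x
    have : e x = 0 ∨ e x = 1 := by
      generalize e x = t
      fin_cases t <;> simp
    rcases this with h | h
    · left; exact e.injective (h.trans ha.symm)
    · right; exact e.injective (h.trans hb.symm)
  have hU : (Finset.univ : Finset V) = {a, b} := by
    ext x; simpa using hall x
  have h1 : gammaR G ≤ 1 := by
    have : IsWRDF G (fun x => if x = a then 1 else 0) := by
      refine ⟨fun x => by dsimp only; split_ifs <;> omega, ?_⟩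
      intro u hu
      have hua : u ≠ a := by rintro rfl; simp at hu
      refine ⟨a, (hA _ _).2 hua, by simp, ?_⟩
      intro w hw
      refine ⟨u, by simp, ?_⟩
      rw [hA]
      rintro rfl
      simp at hw
    have := gammaR_le G _ this
    simpa [wrdfWeight] using this
  obtain ⟨f, hf, hw⟩ := exists_rdf G
  have hw' : rdfWeight f = (f a).card + (f b).card := by
    unfold rdfWeight
    rw [hU, Finset.sum_pair hab]
  have h2 : 2 ≤ (f a).card + (f b).card := by
    by_cases h0 : f a = ∅
    · apply card_two_of_cover
      intro c
      obtain ⟨v, hv, hc⟩ := hf a h0 c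
      rcases hall v with rfl | rfl
      · exact Or.inl hc
      · exact Or.inr hc
    · by_cases h0' : f b = ∅
      · apply card_two_of_cover
        intro c
        obtain ⟨v, hv, hc⟩ := hf b h0' c
        rcases hall v with rfl | rfl
        · exact Or.inl hc
        · exact Or.inr hc
      · have := Finset.card_pos.2 (Finset.nonempty_iff_ne_empty.2 h0)
        have := Finset.card_pos.2 (Finset.nonempty_iff_ne_empty.2 h0')
        omega
  omega

lemma back_tri (G : SimpleGraph V) (k : ℕ) (v w u : Fin k → V)
    (hinj : Function.Injective (Sum.elim v (Sum.elim w u)))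
    (hedge : ∀ a b : V, G.Adj a b →
          (∃ i, ({a, b} : Set V) ⊆ {v i, w i, u i}) ∨ (∃ i j, a = v i ∧ b = v j)) :
    2 * k ≤ gammaR2 G := by
  obtain ⟨f, hf, hwt⟩ := exists_rdf G
  rw [Sum.elim_injective, Sum.elim_injective] at hinj
  obtain ⟨iv, ⟨iw, iu, hwu⟩, hv⟩ := hinj
  have hvw : ∀ i j, v i ≠ w j := fun i j => hv i (Sum.inl j)
  have hvu : ∀ i j, v i ≠ u j := fun i j => hv i (Sum.inr j)
  have nw : ∀ i b, G.Adj (w i) b → b = v i ∨ b = u i := by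
    intro i b hb
    rcases hedge _ _ hb with ⟨j, hj⟩ | ⟨j, l, h1, _⟩
    · have h1 : w i = v j ∨ w i = w j ∨ w i = u j := hj (Or.inl rfl)
      have h2 : b = v j ∨ b = w j ∨ b = u j := hj (Or.inr rfl)
      rcases h1 with h1 | h1 | h1
      · exact absurd h1.symm (hvw _ _)
      · have := iw h1
        subst this
        rcases h2 with h2 | h2 | h2
        · exact Or.inl h2
        · exact absurd h2.symm hb.ne
        · exact Or.inr h2
      · exact absurd h1 (hwu _ _)
    · exact absurd h1.symm (hvw _ _)
  have nu : ∀ i b, G.Adj (u i) b → b = v i ∨ b = w i := by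
    intro i b hb
    rcases hedge _ _ hb with ⟨j, hj⟩ | ⟨j, l, h1, _⟩
    · have h1 : u i = v j ∨ u i = w j ∨ u i = u j := hj (Or.inl rfl)
      have h2 : b = v j ∨ b = w j ∨ b = u j := hj (Or.inr rfl)
      rcases h1 with h1 | h1 | h1
      · exact absurd h1.symm (hvu _ _)
      · exact absurd h1.symm (hwu _ _)
      · have := iu h1
        subst this
        rcases h2 with h2 | h2 | h2
        · exact Or.inl h2
        · exact Or.inr h2
        · exact absurd h2.symm hb.ne
    · exact absurd h1.symm (hvu _ _)
  have hloc : ∀ i, 2 ≤ (f (v i)).card + ((f (w i)).card + (f (u i)).card) := by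
    intro i
    by_cases h0 : f (w i) = ∅
    · have := card_two_of_cover (f (v i)) (f (u i)) (by
        intro c
        obtain ⟨t, ht, hc⟩ := hf _ h0 c
        rcases nw i t ht with rfl | rfl
        · exact Or.inl hc
        · exact Or.inr hc)
      omega
    · by_cases h0' : f (u i) = ∅
      · have := card_two_of_cover (f (v i)) (f (w i)) (by
          intro c
          obtain ⟨t, ht, hc⟩ := hf _ h0' c
          rcases nu i t ht with rfl | rfl
          · exact Or.inl hc
          · exact Or.inr hc)
        omega
      · have := Finset.card_pos.2 (Finset.nonempty_iff_ne_empty.2 h0)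
        have := Finset.card_pos.2 (Finset.nonempty_iff_ne_empty.2 h0')
        omega
  have hinj : Function.Injective (Sum.elim v (Sum.elim w u)) := by
    rw [Sum.elim_injective, Sum.elim_injective]
    exact ⟨iv, ⟨iw, iu, hwu⟩, hv⟩
  have hsum : ∑ i : Fin k, ((f (v i)).card + ((f (w i)).card + (f (u i)).card)) ≤ rdfWeight f := by
    have e1 : ∑ i : Fin k, ((f (v i)).card + ((f (w i)).card + (f (u i)).card)) =
        ∑ t : Fin k ⊕ (Fin k ⊕ Fin k), (f (Sum.elim v (Sum.elim w u) t)).card := by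
      simp [Finset.sum_add_distrib]
    rw [e1]
    unfold rdfWeight
    rw [← Finset.sum_image (s := Finset.univ) (g := Sum.elim v (Sum.elim w u))
      (f := fun x => (f x).card) (fun _ _ _ _ h => hinj h)]
    exact Finset.sum_le_sum_of_subset (Finset.subset_univ _)
  have : ∑ i : Fin k, 2 ≤ ∑ i : Fin k, ((f (v i)).card + ((f (w i)).card + (f (u i)).card)) :=
    Finset.sum_le_sum fun i _ => hloc i
  simp at this
  omega

set_option synthInstance.maxHeartbeats 400000 in
set_option synthInstance.maxSize 4000 in
set_option maxRecDepth 10000 in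
/-- Local counting for case (ii). -/
lemma prism_local (A0 A1 A2 B0 B1 B2 : Finset (Fin 2))
    (a0 : A0 = ∅ → ∀ c, c ∈ A1 ∨ c ∈ A2 ∨ c ∈ B0)
    (a1 : A1 = ∅ → ∀ c, c ∈ A0 ∨ c ∈ A2 ∨ c ∈ B1)
    (a2 : A2 = ∅ → ∀ c, c ∈ A0 ∨ c ∈ A1)
    (b0 : B0 = ∅ → ∀ c, c ∈ B1 ∨ c ∈ B2 ∨ c ∈ A0)
    (b1 : B1 = ∅ → ∀ c, c ∈ B0 ∨ c ∈ B2 ∨ c ∈ A1)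
    (b2 : B2 = ∅ → ∀ c, c ∈ B0 ∨ c ∈ B1) :
    4 ≤ A0.card + A1.card + A2.card + (B0.card + B1.card + B2.card) := by
  revert A0 A1 A2 B0 B1 B2
  decide +kernel

lemma back_prism (G : SimpleGraph V) (x y : Fin 3 → V)
    (hinj : Function.Injective (Sum.elim x y))
    (hall : ∀ z : V, ∃ i, z = x i ∨ z = y i)
    (hadj : ∀ a b : V, G.Adj a b ↔
          ((∃ i j, i ≠ j ∧ a = x i ∧ b = x j) ∨
           (∃ i j, i ≠ j ∧ a = y i ∧ b = y j) ∨
           (∃ i : Fin 3, i ≠ 2 ∧ ((a = x i ∧ b = y i) ∨ (a = y i ∧ b = x i))))) :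
    2 * gammaR G ≤ gammaR2 G := by
  have hinj' := hinj
  rw [Sum.elim_injective] at hinj'
  obtain ⟨ix, iy, hxy⟩ := hinj'
  have hyx : ∀ i j, y i ≠ x j := fun i j => (hxy j i).symm
  have xx : ∀ i j, G.Adj (x i) (x j) ↔ i ≠ j := by
    intro i j
    rw [hadj]
    simp [ix.eq_iff, hxy]
  have yy : ∀ i j, G.Adj (y i) (y j) ↔ i ≠ j := by
    intro i j
    rw [hadj]
    simp [iy.eq_iff, hyx]
  have xy : ∀ i j, G.Adj (x i) (y j) ↔ i = j ∧ i ≠ 2 := by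
    intro i j
    rw [hadj]
    constructor
    · rintro (⟨a, b, -, -, h⟩ | ⟨a, b, -, h, -⟩ | ⟨a, h2, ⟨h, h5⟩ | ⟨h, -⟩⟩)
      · exact absurd h (hyx _ _)
      · exact absurd h (hxy _ _)
      · have h3 := ix h
        have h4 := iy h5
        subst h3 h4
        exact ⟨rfl, h2⟩
      · exact absurd h (hxy _ _)
    · rintro ⟨rfl, h⟩
      exact Or.inr (Or.inr ⟨i, h, Or.inl ⟨rfl, rfl⟩⟩)
  have sumE : ∀ F : V → ℕ, ∑ t, F t = F (x 0) + F (x 1) + F (x 2) + (F (y 0) + F (y 1) + F (y 2)) := by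
    intro F
    have hb : Function.Bijective (Sum.elim x y) := by
      refine ⟨hinj, fun z => ?_⟩
      obtain ⟨i, h | h⟩ := hall z
      · exact ⟨Sum.inl i, h.symm⟩
      · exact ⟨Sum.inr i, h.symm⟩
    rw [← hb.sum_comp F]
    simp [Fin.sum_univ_three]
  have h1 : gammaR G ≤ 2 := by
    let g : V → ℕ := fun t => if t = x 2 ∨ t = y 2 then 1 else 0
    have hg : IsWRDF G g := by
      refine ⟨fun t => by dsimp only [g]; split_ifs <;> omega, ?_⟩
      intro t ht
      obtain ⟨i, rfl | rfl⟩ := hall t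
      · have hi : i ≠ 2 := by rintro rfl; simp [g] at ht
        refine ⟨x 2, (xx _ _).2 hi, by simp [g], ?_⟩
        intro s hs
        obtain ⟨j, rfl | rfl⟩ := hall s
        · refine ⟨x i, by simp, (xx _ _).2 ?_⟩
          rintro rfl
          simp at hs
        · refine ⟨y 2, by simp [g, hyx], (yy _ _).2 ?_⟩
          rintro rfl
          simp [g, hyx] at hs
      · have hi : i ≠ 2 := by rintro rfl; simp [g] at ht
        refine ⟨y 2, (yy _ _).2 hi, by simp [g], ?_⟩
        intro s hs
        obtain ⟨j, rfl | rfl⟩ := hall s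
        · refine ⟨x 2, by simp [g, hxy], (xx _ _).2 ?_⟩
          rintro rfl
          simp [g, hxy] at hs
        · refine ⟨y i, by simp, (yy _ _).2 ?_⟩
          rintro rfl
          simp at hs
    have h := gammaR_le G g hg
    unfold wrdfWeight at h
    rw [sumE] at h
    simpa [g, hxy, hyx, ix.eq_iff, iy.eq_iff] using h
  obtain ⟨f, hf, hw⟩ := exists_rdf G
  unfold rdfWeight at hw
  rw [sumE] at hw
  have hnx : ∀ i, f (x i) = ∅ → ∀ c, (∃ j, i ≠ j ∧ c ∈ f (x j)) ∨ (i ≠ 2 ∧ c ∈ f (y i)) := by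
    intro i h c
    obtain ⟨t, ht, hc⟩ := hf _ h c
    obtain ⟨j, rfl | rfl⟩ := hall t
    · exact Or.inl ⟨j, (xx _ _).1 ht, hc⟩
    · obtain ⟨rfl, h2⟩ := (xy _ _).1 ht
      exact Or.inr ⟨h2, hc⟩
  have hny : ∀ i, f (y i) = ∅ → ∀ c, (∃ j, i ≠ j ∧ c ∈ f (y j)) ∨ (i ≠ 2 ∧ c ∈ f (x i)) := by
    intro i h c
    obtain ⟨t, ht, hc⟩ := hf _ h c
    obtain ⟨j, rfl | rfl⟩ := hall t
    · obtain ⟨rfl, h2⟩ := (xy _ _).1 ht.symm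
      exact Or.inr ⟨h2, hc⟩
    · exact Or.inl ⟨j, (yy _ _).1 ht, hc⟩
  have := prism_local (f (x 0)) (f (x 1)) (f (x 2)) (f (y 0)) (f (y 1)) (f (y 2))
    (fun h c => by have := hnx 0 h c; simp [Fin.exists_fin_succ] at this; tauto)
    (fun h c => by have := hnx 1 h c; simp [Fin.exists_fin_succ] at this; tauto)
    (fun h c => by have := hnx 2 h c; simp [Fin.exists_fin_succ] at this; tauto)
    (fun h c => by have := hny 0 h c; simp [Fin.exists_fin_succ] at this; tauto)
    (fun h c => by have := hny 1 h c; simp [Fin.exists_fin_succ] at this; tauto)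
    (fun h c => by have := hny 2 h c; simp [Fin.exists_fin_succ] at this; tauto)
  omega

end Helpers

/-- Characterization of connected `{K₄, K₄ - e}`-free graphs with `γ_{r2} = 2 γ_r`. -/
theorem characterization_K4_K4e_free {V : Type*} [Fintype V] [DecidableEq V]
    (G : SimpleGraph V) (hconn : G.Connected)
    (hK4 : ∀ s : Set V, ¬ Nonempty (G.induce s ≃g (⊤ : SimpleGraph (Fin 4))))
    (hK4e : ∀ s : Set V, ¬ Nonempty (G.induce s ≃g K4e)) :
    gammaR2 G = 2 * gammaR G ↔
      (Nonempty (G ≃g (⊤ : SimpleGraph (Fin 2)))) ∨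
      (∃ x y : Fin 3 → V,
        Function.Injective (Sum.elim x y) ∧
        (∀ z : V, ∃ i, z = x i ∨ z = y i) ∧
        (∀ a b : V, G.Adj a b ↔
          ((∃ i j, i ≠ j ∧ a = x i ∧ b = x j) ∨
           (∃ i j, i ≠ j ∧ a = y i ∧ b = y j) ∨
           (∃ i : Fin 3, i ≠ 2 ∧ ((a = x i ∧ b = y i) ∨ (a = y i ∧ b = x i)))))) ∨
      (∃ v w u : Fin (gammaR G) → V,
        Function.Injective (Sum.elim v (Sum.elim w u)) ∧
        (∀ z : V, ∃ i, z = v i ∨ z = w i ∨ z = u i) ∧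
        (∀ i, G.Adj (v i) (w i) ∧ G.Adj (v i) (u i) ∧ G.Adj (w i) (u i)) ∧
        (∀ a b : V, G.Adj a b →
          (∃ i, ({a, b} : Set V) ⊆ {v i, w i, u i}) ∨ (∃ i j, a = v i ∧ b = v j))) := by
  constructor
  · intro heq
    have uniq := edge_uniq G hK4 hK4e
    obtain ⟨β, h1, h2⟩ := exists_blocks G uniq heq
    exact abstract_case G hconn uniq β h1 h2 (fun f hf => heq ▸ gammaR2_le G f hf)
  · intro h
    apply le_antisymm (gammaR2_le_two_mul G)
    rcases h with h | ⟨x, y, h1, h2, h3⟩ | ⟨v, w, u, h1, -, -, h4⟩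
    · exact back_K2 G h
    · exact back_prism G x y h1 h2 h3
    · exact back_tri G _ v w u h1 h4
end

section
/- Let G be the graph obtained from two vertex-disjoint triangles by adding a matching consisting of exactly two edges between them. Then γ_r(G) = 2 and γ_{r2}(G) = 4; in particular γ_{r2}(G) = 2·γ_r(G). -/
open Finset

/-- Two disjoint triangles `012` and `345` joined by the matching `03, 14`. -/
def twoTriTwoMatch : SimpleGraph (Fin 6) :=
  SimpleGraph.fromRel (fun a b =>
    (a = 0 ∧ b = 1) ∨ (a = 0 ∧ b = 2) ∨ (a = 1 ∧ b = 2) ∨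
    (a = 3 ∧ b = 4) ∨ (a = 3 ∧ b = 5) ∨ (a = 4 ∧ b = 5) ∨
    (a = 0 ∧ b = 3) ∨ (a = 1 ∧ b = 4))

instance twoTri_decAdj : DecidableRel twoTriTwoMatch.Adj := fun a b => by
  unfold twoTriTwoMatch
  simp only [SimpleGraph.fromRel_adj]
  infer_instance

theorem card_fin2_split (s : Finset (Fin 2)) :
    s.card = (if 0 ∈ s then 1 else 0) + (if 1 ∈ s then 1 else 0) := by
  revert s; decide

theorem rdf_lower (f : Fin 6 → Finset (Fin 2)) (hf : IsRDF twoTriTwoMatch f) :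
    4 ≤ rdfWeight f := by
  have key : ∀ u, (f u).card = 0 → ∀ c : Fin 2,
      1 ≤ ∑ v, if twoTriTwoMatch.Adj u v then (if c ∈ f v then 1 else 0) else 0 := by
    intro u hu c
    obtain ⟨v, hv, hc⟩ := hf u (Finset.card_eq_zero.mp hu) c
    have := Finset.single_le_sum (s := Finset.univ)
      (f := fun v => if twoTriTwoMatch.Adj u v then (if c ∈ f v then 1 else 0) else 0)
      (fun _ _ => Nat.zero_le _) (Finset.mem_univ v)
    simpa [hv, hc] using this
  have k (u : Fin 6) := And.intro (fun h => key u h 0) (fun h => key u h 1)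
  have k0 := k 0
  have k1 := k 1
  have k2 := k 2
  have k3 := k 3
  have k4 := k 4
  have k5 := k 5
  have hb : ∀ (c : Fin 2) (v : Fin 6), (if c ∈ f v then 1 else 0) ≤ 1 := by
    intro c v; split <;> simp
  unfold rdfWeight
  simp only [card_fin2_split] at *
  have hex : ∃ a b : Fin 6 → ℕ, (∀ v, a v = if 0 ∈ f v then 1 else 0) ∧
      (∀ v, b v = if 1 ∈ f v then 1 else 0) := ⟨_, _, fun _ => rfl, fun _ => rfl⟩
  obtain ⟨a, b, ha, hbb⟩ := hex
  simp only [← ha, ← hbb] at k0 k1 k2 k3 k4 k5 ⊢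
  clear k key hf hb ha hbb
  simp [Fin.sum_univ_six, twoTriTwoMatch] at k0 k1 k2 k3 k4 k5 ⊢
  by_contra hlt
  have hX : 1 ≤ a 0 + b 0 + (a 1 + b 1) + (a 2 + b 2) := by clear k0 k1 k3 k4 k5; omega
  have hY : 1 ≤ a 3 + b 3 + (a 4 + b 4) + (a 5 + b 5) := by clear k0 k1 k3 k4 k2; omega
  have hXY : a 0 + b 0 + (a 1 + b 1) + (a 2 + b 2) = 1 ∨
      a 3 + b 3 + (a 4 + b 4) + (a 5 + b 5) = 1 := by clear k0 k1 k2 k3 k4 k5; omega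
  rcases hXY with h | h
  · have h2 : a 2 + b 2 = 1 := by clear k0 k1 k3 k4 k5; omega
    obtain ⟨h0, m0, h1, m1⟩ : a 0 = 0 ∧ b 0 = 0 ∧ a 1 = 0 ∧ b 1 = 0 := by
      clear k0 k1 k2 k3 k4 k5; omega
    have q0 := k0.1 h0 m0
    have r0 := k0.2 h0 m0
    have q1 := k1.1 h1 m1
    have r1 := k1.2 h1 m1
    clear k0 k1 k2 k3 k4
    omega
  · have h2 : a 5 + b 5 = 1 := by clear k0 k1 k3 k4 k2; omega
    obtain ⟨h0, m0, h1, m1⟩ : a 3 = 0 ∧ b 3 = 0 ∧ a 4 = 0 ∧ b 4 = 0 := by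
      clear k0 k1 k2 k3 k4 k5; omega
    have q0 := k3.1 h0 m0
    have r0 := k3.2 h0 m0
    have q1 := k4.1 h1 m1
    have r1 := k4.2 h1 m1
    clear k0 k1 k3 k4 k5
    omega

theorem wrdf_lower (g : Fin 6 → ℕ) (hg : IsWRDF twoTriTwoMatch g) :
    2 ≤ wrdfWeight g := by
  have key : ∀ u, g u = 0 → 1 ≤ ∑ v, if twoTriTwoMatch.Adj u v then g v else 0 := by
    intro u hu
    obtain ⟨v, hv, h1, -⟩ := hg.2 u hu
    have := Finset.single_le_sum (s := Finset.univ)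
      (f := fun v => if twoTriTwoMatch.Adj u v then g v else 0)
      (fun _ _ => Nat.zero_le _) (Finset.mem_univ v)
    simp only [hv, if_true] at this
    omega
  have k2 := key 2
  have k5 := key 5
  unfold wrdfWeight
  simp [Fin.sum_univ_six, twoTriTwoMatch] at k2 k5 ⊢
  omega

theorem wrdf_upper : IsWRDF twoTriTwoMatch ![1, 0, 0, 1, 0, 0] := by
  unfold IsWRDF IsDominatingSet
  simp only [Set.mem_ofPred_eq]
  decide

theorem rdf_upper : IsRDF twoTriTwoMatch ![{0, 1}, ∅, ∅, {0, 1}, ∅, ∅] := by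
  unfold IsRDF
  decide

theorem gammaR_val : gammaR twoTriTwoMatch = 2 := by
  apply le_antisymm
  · exact Nat.sInf_le ⟨_, wrdf_upper, by decide⟩
  · refine le_csInf ⟨_, _, wrdf_upper, rfl⟩ ?_
    rintro w ⟨g, hg, rfl⟩
    exact wrdf_lower g hg

theorem gammaR2_val : gammaR2 twoTriTwoMatch = 4 := by
  apply le_antisymm
  · exact Nat.sInf_le ⟨_, rdf_upper, by decide⟩
  · refine le_csInf ⟨_, _, rdf_upper, rfl⟩ ?_
    rintro w ⟨g, hg, rfl⟩
    exact rdf_lower g hg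

/-- For two disjoint triangles joined by a matching of two edges,
`γ_r = 2` and `γ_{r2} = 4`; in particular `γ_{r2} = 2 γ_r`. -/
theorem twoTriTwoMatch_values :
    gammaR twoTriTwoMatch = 2 ∧ gammaR2 twoTriTwoMatch = 4 ∧
    gammaR2 twoTriTwoMatch = 2 * gammaR twoTriTwoMatch := by
  rw [gammaR_val, gammaR2_val]
  decide
end

section
/- Let k ≥ 1 and let G be a graph obtained from the disjoint union of k triangles v_1w_1u_1, v_2w_2u_2, …, v_kw_ku_k by adding an arbitrary set of edges between vertices of {v_1,…,v_k}. Then γ_r(G) = k and γ_{r2}(G) = 2k; in particular γ_{r2}(G) = 2·γ_r(G). -/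
open Finset

theorem aux_sum {V : Type*} [Fintype V] [DecidableEq V] (k : ℕ)
    (v w u : Fin k → V)
    (hinj : Function.Injective (Sum.elim v (Sum.elim w u)))
    (hcov : ∀ z : V, ∃ i, z = v i ∨ z = w i ∨ z = u i) (h : V → ℕ) :
    ∑ z, h z = ∑ i, (h (v i) + (h (w i) + h (u i))) := by
  have hb : Function.Bijective (Sum.elim v (Sum.elim w u)) := by
    refine ⟨hinj, fun z => ?_⟩
    obtain ⟨i, hi | hi | hi⟩ := hcov z
    · exact ⟨Sum.inl i, by simp [hi]⟩
    · exact ⟨Sum.inr (Sum.inl i), by simp [hi]⟩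
    · exact ⟨Sum.inr (Sum.inr i), by simp [hi]⟩
  rw [← Equiv.sum_comp (Equiv.ofBijective _ hb) h]
  simp [Fintype.sum_sum_type, Finset.sum_add_distrib]

/-- If `G` arises from `k ≥ 1` disjoint triangles `vᵢwᵢuᵢ` by adding edges among the
`vᵢ`'s only, then `γ_r(G) = k` and `γ_{r2}(G) = 2k`. -/
theorem k_triangles_values {V : Type*} [Fintype V] [DecidableEq V]
    (G : SimpleGraph V) (k : ℕ) (hk : 1 ≤ k)
    (v w u : Fin k → V)
    (hinj : Function.Injective (Sum.elim v (Sum.elim w u)))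
    (hcov : ∀ z : V, ∃ i, z = v i ∨ z = w i ∨ z = u i)
    (htri : ∀ i, G.Adj (v i) (w i) ∧ G.Adj (v i) (u i) ∧ G.Adj (w i) (u i))
    (hedges : ∀ a b : V, G.Adj a b →
      (∃ i, ({a, b} : Set V) ⊆ {v i, w i, u i}) ∨ (∃ i j, a = v i ∧ b = v j)) :
    gammaR G = k ∧ gammaR2 G = 2 * k ∧ gammaR2 G = 2 * gammaR G := by
  classical
  have hs := aux_sum k v w u hinj hcov
  have hvv : ∀ i j, v i = v j → i = j := fun i j h => by
    simpa using @hinj (Sum.inl i) (Sum.inl j) (by simpa using h)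
  have hww : ∀ i j, w i = w j → i = j := fun i j h => by
    simpa using @hinj (Sum.inr (Sum.inl i)) (Sum.inr (Sum.inl j)) (by simpa using h)
  have huu : ∀ i j, u i = u j → i = j := fun i j h => by
    simpa using @hinj (Sum.inr (Sum.inr i)) (Sum.inr (Sum.inr j)) (by simpa using h)
  have hvw : ∀ i j, v i ≠ w j := fun i j h => by
    simpa using @hinj (Sum.inl i) (Sum.inr (Sum.inl j)) (by simpa using h)
  have hvu : ∀ i j, v i ≠ u j := fun i j h => by
    simpa using @hinj (Sum.inl i) (Sum.inr (Sum.inr j)) (by simpa using h)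
  have hwu : ∀ i j, w i ≠ u j := fun i j h => by
    simpa using @hinj (Sum.inr (Sum.inl i)) (Sum.inr (Sum.inr j)) (by simpa using h)
  have nw : ∀ i b, G.Adj (w i) b → b = v i ∨ b = u i := by
    intro i b hab
    have hne := hab.ne
    rcases hedges _ _ hab with ⟨j, hj⟩ | ⟨j, l, h1, h2⟩
    · have h1 : w i ∈ ({v j, w j, u j} : Set V) := hj (by simp)
      have h2 : b ∈ ({v j, w j, u j} : Set V) := hj (by simp)
      simp only [Set.mem_insert_iff, Set.mem_singleton_iff] at h1 h2
      grind
    · exact absurd h1.symm (hvw _ _)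
  have nu : ∀ i b, G.Adj (u i) b → b = v i ∨ b = w i := by
    intro i b hab
    have hne := hab.ne
    rcases hedges _ _ hab with ⟨j, hj⟩ | ⟨j, l, h1, h2⟩
    · have h1 : u i ∈ ({v j, w j, u j} : Set V) := hj (by simp)
      have h2 : b ∈ ({v j, w j, u j} : Set V) := hj (by simp)
      simp only [Set.mem_insert_iff, Set.mem_singleton_iff] at h1 h2
      grind
    · exact absurd h1.symm (hvu _ _)
  -- two vertices of one triangle are equal or adjacent
  have tri : ∀ i x y, (x = v i ∨ x = w i ∨ x = u i) → (y = v i ∨ y = w i ∨ y = u i) →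
      x ≠ y → G.Adj x y := by
    intro i x y hx hy hne
    obtain ⟨h1, h2, h3⟩ := htri i
    rcases hx with rfl | rfl | rfl <;> rcases hy with rfl | rfl | rfl <;>
      first | exact absurd rfl hne | assumption | (apply SimpleGraph.Adj.symm; assumption)
  have A : gammaR G = k := by
    apply le_antisymm
    · apply Nat.sInf_le
      refine ⟨fun z => if ∃ i, z = v i then 1 else 0, ⟨?_, ?_⟩, ?_⟩
      · intro x
        dsimp only
        split_ifs <;> omega
      · intro x hx
        obtain ⟨i, hi⟩ := hcov x
        have hxv : ∀ j, x ≠ v j := by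
          intro j hj
          simp [hj] at hx
        refine ⟨v i, tri i _ _ hi (Or.inl rfl) (hxv i), by simp, ?_⟩
        intro y hy
        obtain ⟨j, hj⟩ := hcov y
        by_cases hij : j = i
        · subst hij
          refine ⟨x, by simp, tri j _ _ hj hi ?_⟩
          rintro rfl
          simp at hy
        · have hm : v j ∈ {z | 1 ≤ (if z = x then (if ∃ i, x = v i then 1 else 0) + 1
              else if z = v i then (if ∃ i', v i = v i' then 1 else 0) - 1
              else if ∃ i, z = v i then 1 else 0)} := by
            have h1 : v j ≠ x := (hxv j).symm
            have h2 : v j ≠ v i := fun h => hij (hvv _ _ h)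
            simp [h1, h2]
          refine ⟨v j, hm, tri j _ _ hj (Or.inl rfl) ?_⟩
          rintro rfl
          exact hy hm
      · unfold wrdfWeight
        rw [hs]
        have h1 : ∀ i, ¬ ∃ j, w i = v j := fun i ⟨j, h⟩ => hvw _ _ h.symm
        have h2 : ∀ i, ¬ ∃ j, u i = v j := fun i ⟨j, h⟩ => hvu _ _ h.symm
        simp [h1, h2]
    · apply le_csInf
      · exact ⟨_, fun _ => 1, ⟨by simp, by simp⟩, rfl⟩
      · rintro _ ⟨g, ⟨-, hg⟩, rfl⟩
        unfold wrdfWeight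
        rw [hs]
        calc k = ∑ i : Fin k, 1 := by simp
          _ ≤ _ := Finset.sum_le_sum fun i _ => by
            by_cases h0 : g (w i) = 0
            · obtain ⟨b, hb, hb1, -⟩ := hg _ h0
              rcases nw i b hb with rfl | rfl <;> omega
            · omega
  have B : gammaR2 G = 2 * k := by
    apply le_antisymm
    · apply Nat.sInf_le
      refine ⟨fun z => if ∃ i, z = v i then Finset.univ else ∅, ?_, ?_⟩
      · intro x hx c
        obtain ⟨i, hi⟩ := hcov x
        refine ⟨v i, tri i _ _ hi (Or.inl rfl) ?_, by simp⟩
        rintro rfl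
        simp at hx
        exact absurd hx (by decide)
      · unfold rdfWeight
        rw [hs]
        have h1 : ∀ i, ¬ ∃ j, w i = v j := fun i ⟨j, h⟩ => hvw _ _ h.symm
        have h2 : ∀ i, ¬ ∃ j, u i = v j := fun i ⟨j, h⟩ => hvu _ _ h.symm
        simp [h1, h2, mul_comm]
    · apply le_csInf
      · exact ⟨_, fun _ => Finset.univ, fun x hx => absurd hx (by dsimp only; decide), rfl⟩
      · rintro _ ⟨f, hf, rfl⟩
        unfold rdfWeight
        rw [hs]
        have key : ∀ s t : Finset (Fin 2), (∀ c, c ∈ s ∨ c ∈ t) → 2 ≤ s.card + t.card := by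
          decide
        calc 2 * k = ∑ i : Fin k, 2 := by simp [mul_comm]
          _ ≤ _ := Finset.sum_le_sum fun i _ => by
            by_cases h0 : f (w i) = ∅
            · have := key (f (v i)) (f (u i)) fun c => by
                obtain ⟨b, hb, hc⟩ := hf _ h0 c
                rcases nw i b hb with rfl | rfl <;> simp [hc]
              omega
            · by_cases h1 : f (u i) = ∅
              · have := key (f (v i)) (f (w i)) fun c => by
                  obtain ⟨b, hb, hc⟩ := hf _ h1 c
                  rcases nu i b hb with rfl | rfl <;> simp [hc]
                omega
              · have h2 := Finset.card_pos.2 (Finset.nonempty_iff_ne_empty.2 h0)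
                have h3 := Finset.card_pos.2 (Finset.nonempty_iff_ne_empty.2 h1)
                omega
  exact ⟨A, B, by rw [A, B]⟩
end

section
/- Let G be the triangular prism, i.e., the graph obtained from two vertex-disjoint triangles by adding a perfect matching (three edges) between them. Then γ_{r2}(G) = 3 and γ_r(G) = 2; in particular γ_{r2}(G) < 2·γ_r(G). -/
open Finset

/-- The triangular prism: triangles `012` and `345` joined by the perfect matching
`03, 14, 25`. -/
def triangularPrism : SimpleGraph (Fin 6) :=
  SimpleGraph.fromRel (fun a b =>
    (a = 0 ∧ b = 1) ∨ (a = 0 ∧ b = 2) ∨ (a = 1 ∧ b = 2) ∨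
    (a = 3 ∧ b = 4) ∨ (a = 3 ∧ b = 5) ∨ (a = 4 ∧ b = 5) ∨
    (a = 0 ∧ b = 3) ∨ (a = 1 ∧ b = 4) ∨ (a = 2 ∧ b = 5))

instance : DecidableRel triangularPrism.Adj := by
  unfold triangularPrism; infer_instance

/-- The closed neighborhood inequality for 2-rainbow dominating functions. -/
theorem rdf_local (f : Fin 6 → Finset (Fin 2)) (h : IsRDF triangularPrism f) (u : Fin 6) :
    2 ≤ 2 * (f u).card + ∑ v ∈ univ.filter (fun v => triangularPrism.Adj u v), (f v).card := by
  by_cases hu : f u = ∅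
  · have h1 : (univ : Finset (Fin 2)) ⊆
        (univ.filter (fun v => triangularPrism.Adj u v)).biUnion f := by
      intro c _
      obtain ⟨v, hv, hc⟩ := h u hu c
      simp only [mem_biUnion, mem_filter, mem_univ, true_and]
      exact ⟨v, hv, hc⟩
    have h2 := (card_le_card h1).trans card_biUnion_le
    simp only [card_univ, Fintype.card_fin] at h2
    omega
  · have := card_pos.mpr (nonempty_iff_ne_empty.mpr hu)
    omega

/-- The closed neighborhood inequality for weak Roman dominating functions. -/
theorem wrdf_local (g : Fin 6 → ℕ) (h : IsWRDF triangularPrism g) (u : Fin 6) :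
    1 ≤ g u + ∑ v ∈ univ.filter (fun v => triangularPrism.Adj u v), g v := by
  by_cases hu : g u = 0
  · obtain ⟨v, hv, h1, _⟩ := h.2 u hu
    have := single_le_sum (f := g) (s := univ.filter (fun v => triangularPrism.Adj u v))
      (fun _ _ => Nat.zero_le _) (a := v) (by simpa using hv)
    omega
  · omega

/-- Every vertex of the prism has degree three. -/
theorem prism_sum (a : Fin 6 → ℕ) :
    ∑ u, ∑ v ∈ univ.filter (fun v => triangularPrism.Adj u v), a v = 3 * ∑ u, a u := by
  have hd : ∀ v, (univ.filter (fun u => triangularPrism.Adj u v)).card = 3 := by decide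
  simp_rw [sum_filter]
  rw [sum_comm, mul_sum]
  refine sum_congr rfl fun v _ => ?_
  rw [← sum_filter, sum_const, hd, smul_eq_mul]

theorem gammaR2_prism : gammaR2 triangularPrism = 3 := by
  apply le_antisymm
  · refine Nat.sInf_le ⟨![{0}, ∅, {0}, ∅, {1}, ∅], ?_, by decide⟩
    unfold IsRDF
    decide
  · refine le_csInf ⟨_, fun _ => univ, ?_, rfl⟩ ?_
    · intro u hu
      exact absurd hu univ_nonempty.ne_empty
    · rintro w ⟨f, hf, rfl⟩
      have h := sum_le_sum fun u (_ : u ∈ univ) => rdf_local f hf u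
      rw [sum_add_distrib, prism_sum (fun v => (f v).card), ← mul_sum] at h
      simp only [sum_const, card_univ, Fintype.card_fin, smul_eq_mul] at h
      unfold rdfWeight
      omega

theorem gammaR_prism : gammaR triangularPrism = 2 := by
  apply le_antisymm
  · refine Nat.sInf_le ⟨![1, 0, 0, 0, 1, 0], ?_, by decide⟩
    unfold IsWRDF IsDominatingSet
    simp only [Set.mem_setOf_eq]
    decide
  · refine le_csInf ⟨_, fun _ => 1, ⟨fun _ => by simp, fun u hu => ?_⟩, rfl⟩ ?_
    · exact absurd hu one_ne_zero
    · rintro w ⟨g, hg, rfl⟩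
      have h := sum_le_sum fun u (_ : u ∈ univ) => wrdf_local g hg u
      rw [sum_add_distrib, prism_sum g] at h
      simp only [sum_const, card_univ, Fintype.card_fin, smul_eq_mul] at h
      unfold wrdfWeight
      omega

/-- For the triangular prism, `γ_{r2} = 3` and `γ_r = 2`; in particular
`γ_{r2} < 2 γ_r`. -/
theorem triangularPrism_values :
    gammaR2 triangularPrism = 3 ∧ gammaR triangularPrism = 2 ∧
    gammaR2 triangularPrism < 2 * gammaR triangularPrism := by
  rw [gammaR2_prism, gammaR_prism]
  norm_num
end

section
/- For every finite simple graph G, the following are equivalent: (1) every induced subgraph H of G with γ_r(H) ≥ 3 satisfies γ_{r2}(H) = 2·γ_r(H); (2) G contains no independent set of three vertices and no induced cycle of length 5. -/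
open Finset

theorem gammaR2_le_card {V : Type*} [Fintype V] [DecidableEq V] (G : SimpleGraph V) :
    gammaR2 G ≤ Fintype.card V := by
  apply Nat.sInf_le
  refine ⟨fun _ => {0}, ?_, by simp [rdfWeight]⟩
  intro u hu
  simp at hu

theorem le_gammaR {V : Type*} [Fintype V] [DecidableEq V] (G : SimpleGraph V) (n : ℕ)
    (h : ∀ g, IsWRDF G g → n ≤ ∑ u, g u) : n ≤ gammaR G := by
  apply le_csInf
  · refine ⟨_, fun _ => 1, ⟨fun _ => by norm_num, ?_⟩, rfl⟩
    intro u hu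
    simp at hu
  · rintro w ⟨g, hg, rfl⟩
    exact h g hg

/-- `γ_r ≤ 2` in a graph without independent triples and induced 5-cycles. -/
theorem gammaR_le_two {V : Type*} [Fintype V] [DecidableEq V] (G : SimpleGraph V)
    (h3 : ∀ a b c : V, a ≠ b → a ≠ c → b ≠ c → ¬ G.Adj a b → ¬ G.Adj a c → ¬ G.Adj b c → False)
    (h5 : ∀ u a w z b : V, G.Adj u a → G.Adj a w → G.Adj w z → G.Adj z b → G.Adj b u →
      ¬ G.Adj u w → ¬ G.Adj u z → ¬ G.Adj a z → ¬ G.Adj a b → ¬ G.Adj w b →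
      u ≠ w → u ≠ z → a ≠ z → a ≠ b → w ≠ b → False) : gammaR G ≤ 2 := by
  by_cases hc : ∃ a b : V, a ≠ b ∧ ¬ G.Adj a b
  · obtain ⟨a, b, hab, nab⟩ := hc
    have key : ∀ a b : V, a ≠ b → ¬ G.Adj a b → ∀ u, u ≠ a → u ≠ b → G.Adj u a →
        (∀ w, w ≠ u → w ≠ b → G.Adj w u ∨ G.Adj w b) →
        IsDominatingSet G {x | 1 ≤ (if x = u then (if u = a ∨ u = b then 1 else 0) + 1
          else if x = a then (if a = a ∨ a = b then 1 else 0) - 1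
          else (if x = a ∨ x = b then 1 else 0))} := by
      intro a b hab nab u hua hub adj hd w hw
      have hwu : w ≠ u := by rintro rfl; simp at hw
      have hwb : w ≠ b := by rintro rfl; simp [Ne.symm hab, Ne.symm hub] at hw
      rcases hd w hwu hwb with h | h
      · exact ⟨u, by simp, h⟩
      · exact ⟨b, by simp [Ne.symm hab, Ne.symm hub], h⟩
    apply Nat.sInf_le
    refine ⟨fun x => if x = a ∨ x = b then 1 else 0, ⟨fun x => by dsimp only; split_ifs <;> norm_num, ?_⟩, ?_⟩
    · intro u hu
      have hua : u ≠ a := by rintro rfl; simp at hu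
      have hub : u ≠ b := by rintro rfl; simp at hu
      by_cases hA : G.Adj u a ∧ ∀ w, w ≠ u → w ≠ b → G.Adj w u ∨ G.Adj w b
      · exact ⟨a, hA.1, by simp, key a b hab nab u hua hub hA.1 hA.2⟩
      by_cases hB : G.Adj u b ∧ ∀ w, w ≠ u → w ≠ a → G.Adj w u ∨ G.Adj w a
      · have := key b a hab.symm (fun h => nab h.symm) u hub hua hB.1 hB.2
        simp only [or_comm (b := _ = a)] at this
        refine ⟨b, hB.1, by simp, ?_⟩
        simpa only [or_comm] using this
      exfalso
      have sy := fun x y => G.adj_comm x y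
      by_cases ha : G.Adj u a <;> by_cases hb : G.Adj u b
      · simp only [ha, hb, true_and] at hA hB
        push Not at hA hB
        obtain ⟨w, hwu, hwb, nwu, nwb⟩ := hA
        obtain ⟨z, hzu, hza, nzu, nza⟩ := hB
        have hwa : w ≠ a := by rintro rfl; exact nwu ha.symm
        have hzb : z ≠ b := by rintro rfl; exact nzu hb.symm
        have aw : G.Adj a w := by
          by_contra h; exact h3 a w b hwa.symm hab hwb h nab nwb
        have zb : G.Adj z b := by
          by_contra h; exact h3 z b a hzb hza hab.symm h nza (fun h => nab h.symm)
        have wz : G.Adj w z := by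
          by_contra h
          refine h3 w z u ?_ hwu hzu h nwu nzu
          rintro rfl; exact nza aw.symm
        exact h5 u a w z b ha aw wz zb hb.symm (fun h => nwu h.symm) (fun h => nzu h.symm)
          (fun h => nza h.symm) nab nwb hwu.symm hzu.symm hza.symm hab hwb
      · apply hA ⟨ha, fun w h1 h2 => ?_⟩
        by_contra h
        push Not at h
        exact h3 w u b h1 h2 hub h.1 h.2 hb
      · apply hB ⟨hb, fun w h1 h2 => ?_⟩
        by_contra h
        push Not at h
        exact h3 w u a h1 h2 hua h.1 h.2 ha
      · exact h3 u a b hua hub hab ha hb nab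
    · show ∑ u, (if u = a ∨ u = b then 1 else 0) = 2
      rw [← Finset.card_filter]
      have : (Finset.univ.filter fun x => x = a ∨ x = b) = {a, b} := by ext; simp
      rw [this, Finset.card_pair hab]
  · push Not at hc
    rcases isEmpty_or_nonempty V with hV | ⟨⟨a⟩⟩
    · refine le_trans (b := wrdfWeight fun _ : V => 0) (Nat.sInf_le
        ⟨fun _ => 0, ⟨fun _ => by norm_num, fun u => isEmptyElim u⟩, rfl⟩) ?_
      simp [wrdfWeight]
    · refine le_trans (b := wrdfWeight fun x : V => if x = a then 1 else 0)
        (Nat.sInf_le ⟨fun x => if x = a then 1 else 0,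
        ⟨fun x => by dsimp only; split_ifs <;> norm_num, fun u hu => ?_⟩, rfl⟩) ?_
      · have hua : u ≠ a := by rintro rfl; simp at hu
        refine ⟨a, hc _ _ hua, by simp, fun w hw => ⟨u, by simp, hc _ _ ?_⟩⟩
        rintro rfl; simp at hw
      · simp [wrdfWeight]

theorem c5_check : ∀ a b c d e : Fin 3, a.val + b.val + c.val + d.val + e.val ≤ 2 →
    ¬ ∀ u : Fin 5, (![a,b,c,d,e] u).val = 0 → ∃ v : Fin 5, (v = u + 1 ∨ u = v + 1) ∧
      1 ≤ (![a,b,c,d,e] v).val ∧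
      ∀ x : Fin 5, (1 ≤ (if x = u then (![a,b,c,d,e] u).val + 1 else if x = v then
        (![a,b,c,d,e] v).val - 1 else (![a,b,c,d,e] x).val)) ∨
        ∃ y : Fin 5, (1 ≤ (if y = u then (![a,b,c,d,e] u).val + 1 else if y = v then
        (![a,b,c,d,e] v).val - 1 else (![a,b,c,d,e] y).val)) ∧ (y = x + 1 ∨ x = y + 1) := by
  decide +kernel

theorem c5_bound {V : Type*} [Fintype V] [DecidableEq V] (G : SimpleGraph V)
    (e : Fin 5 ≃ V) (he : ∀ i j, G.Adj (e i) (e j) ↔ (j = i + 1 ∨ i = j + 1)) :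
    3 ≤ gammaR G := by
  apply le_gammaR
  intro g hg
  by_contra hlt
  rw [← Equiv.sum_comp e, Fin.sum_univ_five] at hlt
  have hb : ∀ i, g (e i) < 3 := fun i => Nat.lt_succ_of_le (hg.1 _)
  have hv : ∀ i, (![(⟨g (e 0), hb 0⟩ : Fin 3), ⟨g (e 1), hb 1⟩, ⟨g (e 2), hb 2⟩,
      ⟨g (e 3), hb 3⟩, ⟨g (e 4), hb 4⟩] i).val = g (e i) := by
    intro i; fin_cases i <;> rfl
  apply c5_check ⟨g (e 0), hb 0⟩ ⟨g (e 1), hb 1⟩ ⟨g (e 2), hb 2⟩ ⟨g (e 3), hb 3⟩ ⟨g (e 4), hb 4⟩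
    (by simp only; omega)
  intro u hu
  simp only [hv] at hu ⊢
  obtain ⟨v, h1, h2, h3⟩ := hg.2 (e u) hu
  obtain ⟨v, rfl⟩ := e.surjective v
  refine ⟨v, (he _ _).1 h1, h2, fun x => ?_⟩
  by_cases hx : e x ∈ {x | 1 ≤ (if x = e u then g (e u) + 1 else if x = e v then g (e v) - 1 else g x)}
  · left
    simpa only [Set.mem_ofPred_eq, e.injective.eq_iff] using hx
  · right
    obtain ⟨y, hy, hadj⟩ := h3 _ hx
    obtain ⟨y, rfl⟩ := e.surjective y
    refine ⟨y, ?_, (he _ _).1 hadj⟩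
    simpa only [Set.mem_ofPred_eq, e.injective.eq_iff] using hy

/-- Every induced subgraph `H` with `γ_r(H) ≥ 3` satisfies `γ_{r2}(H) = 2 γ_r(H)` iff
`G` has no independent set of three vertices and no induced cycle of length 5. -/
theorem G3_characterization {V : Type*} [Fintype V] [DecidableEq V]
    (G : SimpleGraph V) :
    (∀ s : Finset V, 3 ≤ gammaR (G.induce (s : Set V)) →
        gammaR2 (G.induce (s : Set V)) = 2 * gammaR (G.induce (s : Set V))) ↔
      ((¬ ∃ a b c : V, a ≠ b ∧ a ≠ c ∧ b ≠ c ∧ ¬ G.Adj a b ∧ ¬ G.Adj a c ∧ ¬ G.Adj b c) ∧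
       (¬ ∃ f : Fin 5 → V, Function.Injective f ∧
          ∀ i j : Fin 5, G.Adj (f i) (f j) ↔ (j = i + 1 ∨ i = j + 1))) := by

  constructor
  · intro H
    have big : ∀ s : Finset V, s.card ≤ 5 → ¬ 3 ≤ gammaR (G.induce (s : Set V)) := by
      intro s hs h
      have h1 := H s h
      have h2 := gammaR2_le_card (G.induce (s : Set V))
      have h3 : Fintype.card (s : Set V) = s.card := by simp
      omega
    constructor
    · rintro ⟨a, b, c, hab, hac, hbc, nab, nac, nbc⟩
      have hcard : ({a, b, c} : Finset V).card = 3 := Finset.card_eq_three.2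
        ⟨a, b, c, hab, hac, hbc, rfl⟩
      refine big {a, b, c} (by omega) (le_gammaR _ _ fun g hg => ?_)
      have hpos : ∀ u, 1 ≤ g u := by
        intro u
        by_contra hu
        obtain ⟨v, hv, -⟩ := hg.2 u (by omega)
        obtain ⟨u, hu'⟩ := u
        obtain ⟨v, hv'⟩ := v
        have hadj : G.Adj u v := hv
        have n1 : ¬ G.Adj b a := fun h => nab h.symm
        have n2 : ¬ G.Adj c a := fun h => nac h.symm
        have n3 : ¬ G.Adj c b := fun h => nbc h.symm
        simp only [Finset.coe_insert, Finset.coe_singleton, Set.mem_insert_iff,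
          Set.mem_singleton_iff] at hu' hv'
        rcases hu' with rfl | rfl | rfl <;> rcases hv' with rfl | rfl | rfl <;>
          first | exact G.irrefl hadj | contradiction
      calc 3 = ∑ u : (({a, b, c} : Finset V) : Set V), 1 := by
            rw [Finset.sum_const, Finset.card_univ]
            have h3 : Fintype.card ((({a, b, c} : Finset V) : Set V)) = ({a, b, c} : Finset V).card := by
              rw [← Set.toFinset_card, Finset.toFinset_coe]
            rw [h3, hcard]; rfl
        _ ≤ _ := Finset.sum_le_sum fun u _ => hpos u
    · rintro ⟨f, hf, hadj⟩
      have hcard : (Finset.univ.image f).card = 5 := by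
        rw [Finset.card_image_of_injective _ hf]; rfl
      refine big (Finset.univ.image f) (by omega) ?_
      let e : Fin 5 ≃ ((Finset.univ.image f : Finset V) : Set V) :=
        Equiv.ofBijective (fun i => ⟨f i, by simp⟩)
          ⟨fun i j h => hf (congrArg Subtype.val h), by
            rintro ⟨x, hx⟩
            simp only [Finset.coe_image, Finset.coe_univ, Set.image_univ, Set.mem_range] at hx
            obtain ⟨i, rfl⟩ := hx
            exact ⟨i, rfl⟩⟩
      exact c5_bound _ e (fun i j => hadj i j)
  · rintro ⟨h3, h5⟩ s hs
    exfalso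
    have : gammaR (G.induce (s : Set V)) ≤ 2 := by
      apply gammaR_le_two
      · intro a b c hab hac hbc n1 n2 n3
        exact h3 ⟨a, b, c, fun h => hab (Subtype.ext h), fun h => hac (Subtype.ext h),
          fun h => hbc (Subtype.ext h), n1, n2, n3⟩
      · intro u a w z b e1 e2 e3 e4 e5 n1 n2 n3 n4 n5 d1 d2 d3 d4 d5
        have q1 := e1.ne
        have q2 := e2.ne
        have q3 := e3.ne
        have q4 := e4.ne
        have q5 := e5.ne
        simp only [SimpleGraph.comap_adj, Function.Embedding.subtype_apply] at e1 e2 e3 e4 e5 n1 n2 n3 n4 n5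
        simp only [ne_eq, Subtype.ext_iff] at d1 d2 d3 d4 d5 q1 q2 q3 q4 q5
        refine h5 ⟨![(u : V), a, w, z, b], ?_, ?_⟩
        · intro i j hij
          fin_cases i <;> fin_cases j <;> first | rfl | (exfalso; simp at hij; grind)
        · intro i j
          fin_cases i <;> fin_cases j <;>
            simp [e1, e2, e3, e4, e5, e1.symm, e2.symm, e3.symm, e4.symm, e5.symm,
              n1, n2, n3, n4, n5, mt G.adj_symm n1, mt G.adj_symm n2, mt G.adj_symm n3, mt G.adj_symm n4,
              mt G.adj_symm n5] <;> decide
    omega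
end

section
/- Every finite simple graph G with at least one vertex that contains no independent set of three vertices and no induced cycle of length 5 satisfies γ_r(G) ≤ 2. -/
open Finset

/-- A nonempty graph with no independent set of three vertices and no induced
cycle of length five satisfies `γ_r(G) ≤ 2`. -/
theorem no_K3bar_no_C5_gammaR_le_two {V : Type*} [Fintype V] [DecidableEq V]
    [Nonempty V] (G : SimpleGraph V)
    (h1 : ¬ ∃ a b c : V, a ≠ b ∧ a ≠ c ∧ b ≠ c ∧ ¬ G.Adj a b ∧ ¬ G.Adj a c ∧ ¬ G.Adj b c)
    (h2 : ¬ ∃ f : Fin 5 → V, Function.Injective f ∧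
        ∀ i j : Fin 5, G.Adj (f i) (f j) ↔ (j = i + 1 ∨ i = j + 1)) :
    gammaR G ≤ 2 := by
  classical
  by_cases hc : ∀ a b : V, a ≠ b → G.Adj a b
  · obtain ⟨v⟩ := ‹Nonempty V›
    refine Nat.sInf_le ⟨fun x => if x = v then 2 else 0, ⟨?_, ?_⟩, ?_⟩
    · intro x
      dsimp only
      split_ifs <;> omega
    · intro u hu
      have huv : u ≠ v := by
        rintro rfl
        simp at hu
      refine ⟨v, hc u v huv, by simp, ?_⟩
      intro w hw
      refine ⟨u, by simp, hc w u ?_⟩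
      rintro rfl
      simp at hw
    · simp [wrdfWeight]
  · push Not at hc
    obtain ⟨a, b, hab, hnab⟩ := hc
    refine Nat.sInf_le ⟨fun x => if x = a ∨ x = b then 1 else 0, ⟨?_, ?_⟩, ?_⟩
    · intro x
      dsimp only
      split_ifs <;> omega
    · intro u hu
      have hu' : u ≠ a ∧ u ≠ b := by
        by_contra h
        have : u = a ∨ u = b := by tauto
        simp [this] at hu
      obtain ⟨hua, hub⟩ := hu'
      have hns : ∀ p q r : V, p ≠ q → p ≠ r → q ≠ r → ¬ G.Adj p q → ¬ G.Adj p r →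
          G.Adj q r := by
        intro p q r k1 k2 k3 k4 k5
        by_contra k6
        exact h1 ⟨p, q, r, k1, k2, k3, k4, k5, k6⟩
      have key : (G.Adj u a ∧ ∀ w, w ≠ u → w ≠ b → G.Adj w u ∨ G.Adj w b) ∨
          (G.Adj u b ∧ ∀ w, w ≠ u → w ≠ a → G.Adj w u ∨ G.Adj w a) := by
        by_cases k1 : G.Adj u a
        · by_cases k2 : G.Adj u b
          · by_contra hcon
            push Not at hcon
            obtain ⟨x, hxu, hxb, nxu, nxb⟩ := hcon.1 k1
            obtain ⟨y, hyu, hya, nyu, nya⟩ := hcon.2 k2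
            have hxa : x ≠ a := by
              rintro rfl
              exact nxu k1.symm
            have hyb : y ≠ b := by
              rintro rfl
              exact nyu k2.symm
            have axa : G.Adj a x := hns b a x hab.symm hxb.symm hxa.symm
              (fun h => hnab h.symm) (fun h => nxb h.symm)
            have ayb : G.Adj y b := hns a y b hya.symm hab hyb (fun h => nya h.symm) hnab
            have hxy : x ≠ y := by
              rintro rfl
              exact nya axa.symm
            have axy : G.Adj x y := hns u x y hxu.symm hyu.symm hxy
              (fun h => nxu h.symm) (fun h => nyu h.symm)
            apply h2
            refine ⟨![u, a, x, y, b], ?_, ?_⟩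
            · intro i j
              fin_cases i <;> fin_cases j <;>
                simp [hua, hub, hxu, hxb, hyu, hya, hxa, hyb, hxy, hab, hua.symm, hub.symm,
                  hxu.symm, hxb.symm, hyu.symm, hya.symm, hxa.symm, hyb.symm, hxy.symm, hab.symm]
            · have e1 : ¬ G.Adj b a := fun h => hnab h.symm
              have e2 : ¬ G.Adj u x := fun h => nxu h.symm
              have e3 : ¬ G.Adj b x := fun h => nxb h.symm
              have e4 : ¬ G.Adj u y := fun h => nyu h.symm
              have e5 : ¬ G.Adj a y := fun h => nya h.symm
              intro i j
              fin_cases i <;> fin_cases j <;>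
                simp [k1, k2, k1.symm, k2.symm, axa, axa.symm, ayb, ayb.symm, axy, axy.symm,
                  hnab, nxu, nxb, nyu, nya, e1, e2, e3, e4, e5]
          · left
            refine ⟨k1, fun w hwu hwb => ?_⟩
            by_contra h
            push Not at h
            exact k2 (hns w u b hwu hwb hub h.1 h.2)
        · right
          refine ⟨?_, fun w hwu hwa => ?_⟩
          · exact hns a u b hua.symm hab hub (fun h => k1 h.symm) hnab
          · by_contra h
            push Not at h
            exact k1 (hns w u a hwu hwa hua h.1 h.2)
      rcases key with ⟨k, hk⟩ | ⟨k, hk⟩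
      · refine ⟨a, k, by simp, ?_⟩
        intro w hw
        have hwu : w ≠ u := by
          rintro rfl
          simp at hw
        have hwb : w ≠ b := by
          rintro rfl
          simp [hab.symm, hwu] at hw
        rcases hk w hwu hwb with h | h
        · exact ⟨u, by simp, h⟩
        · exact ⟨b, by simp [hab.symm, hub.symm], h⟩
      · refine ⟨b, k, by simp, ?_⟩
        intro w hw
        have hwu : w ≠ u := by
          rintro rfl
          simp at hw
        have hwa : w ≠ a := by
          rintro rfl
          simp [hab, hwu] at hw
        rcases hk w hwu hwa with h | h
        · exact ⟨u, by simp, h⟩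
        · exact ⟨a, by simp [hab, hua.symm], h⟩
    · have hf : (Finset.univ.filter fun x => x = a ∨ x = b) = {a, b} := by
        ext x
        simp
      unfold wrdfWeight
      rw [← Finset.card_filter, hf, Finset.card_pair hab]
end

section
/- Let F be a 3-SAT formula with m ≥ 2 clauses over n variables, and let G_F be the graph constructed from F as described. Then γ_{r2}(G_F) = 2n + 2. -/
open Finset

/-- The vertex type of the graph `G_F` associated with a 3-SAT formula with `n`
variables and `m` clauses: a copy of `K₄` for each variable (the vertices labelled
`0` and `1` playing the roles of the literals `xᵢ` and `x̄ᵢ`), one vertex per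
clause, and the two vertices `a` and `b`. -/
abbrev SatVert (n m : ℕ) := (Fin n × Fin 4) ⊕ (Fin m ⊕ Fin 2)

/-- The base relation for the graph `G_F`: each variable gadget is complete,
literal vertices are joined to the clauses containing them, and `a`, `b` are
joined to each other and to all clause vertices. -/
def satRel (n m : ℕ) (F : Fin m → Finset (Fin n ⊕ Fin n)) :
    SatVert n m → SatVert n m → Prop
  | Sum.inl (i, _), Sum.inl (i', _) => i = i'
  | Sum.inl (i, s), Sum.inr (Sum.inl j) =>
      (s = 0 ∧ Sum.inl i ∈ F j) ∨ (s = 1 ∧ Sum.inr i ∈ F j)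
  | Sum.inr (Sum.inl _), Sum.inr (Sum.inr _) => True
  | Sum.inr (Sum.inr _), Sum.inr (Sum.inr _) => True
  | _, _ => False

/-- The graph `G_F` associated with a 3-SAT formula `F`. -/
def satGraph (n m : ℕ) (F : Fin m → Finset (Fin n ⊕ Fin n)) :
    SimpleGraph (SatVert n m) :=
  SimpleGraph.fromRel (satRel n m F)

/-- A truth assignment `σ` satisfies `F` if every clause contains a true literal
(`Sum.inl i` is the literal `xᵢ`, `Sum.inr i` is the literal `x̄ᵢ`). -/
def Satisfies {n m : ℕ} (σ : Fin n → Bool) (F : Fin m → Finset (Fin n ⊕ Fin n)) : Prop :=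
  ∀ j, ∃ l ∈ F j, (match l with | Sum.inl i => σ i = true | Sum.inr i => σ i = false)



lemma rdf_local_s13 {V ι : Type*} [Fintype V] [DecidableEq V] [Fintype ι] (G : SimpleGraph V)
    (f : V → Finset (Fin 2)) (hf : IsRDF G f) (e : ι → V) (p q : ι) (hpq : p ≠ q)
    (hp : ∀ v, G.Adj (e p) v → ∃ i, e i = v) (hq : ∀ v, G.Adj (e q) v → ∃ i, e i = v) :
    2 ≤ ∑ i, (f (e i)).card := by
  classical
  have key : ∀ r, (∀ v, G.Adj (e r) v → ∃ i, e i = v) → f (e r) = ∅ →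
      2 ≤ ∑ i, (f (e i)).card := by
    intro r hr h0
    have h1 : (Finset.univ.biUnion fun i => f (e i)) = (Finset.univ : Finset (Fin 2)) := by
      ext c
      simp only [Finset.mem_biUnion, Finset.mem_univ, true_and, iff_true]
      obtain ⟨v, hv, hc⟩ := hf _ h0 c
      obtain ⟨i, rfl⟩ := hr v hv
      exact ⟨i, hc⟩
    have h2 := Finset.card_biUnion_le (s := Finset.univ) (t := fun i => f (e i))
    rw [h1] at h2
    simpa using h2
  by_cases h1 : f (e p) = ∅
  · exact key p hp h1
  by_cases h2 : f (e q) = ∅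
  · exact key q hq h2
  have h3 := Finset.card_pos.2 (Finset.nonempty_iff_ne_empty.2 h1)
  have h4 := Finset.card_pos.2 (Finset.nonempty_iff_ne_empty.2 h2)
  have h5 : ∑ i ∈ ({p, q} : Finset ι), (f (e i)).card ≤ ∑ i, (f (e i)).card :=
    Finset.sum_le_sum_of_subset (Finset.subset_univ _)
  rw [Finset.sum_pair hpq] at h5
  omega

/-- An optimal function. -/
def optF (n m : ℕ) : SatVert n m → Finset (Fin 2)
  | Sum.inl (_, s) => if s = 0 then Finset.univ else ∅
  | Sum.inr (Sum.inl _) => ∅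
  | Sum.inr (Sum.inr k) => {k}

lemma optF_isRDF (n m : ℕ) (F : Fin m → Finset (Fin n ⊕ Fin n)) :
    IsRDF (satGraph n m F) (optF n m) := by
  rintro (⟨i, s⟩ | j | k) h c
  · refine ⟨Sum.inl (i, 0), ?_, ?_⟩
    · by_cases hs : s = 0
      · simp [optF, hs] at h
        exact absurd h (by decide)
      · simp [satGraph, satRel, hs]
    · simp [optF]
  · refine ⟨Sum.inr (Sum.inr c), ?_, ?_⟩
    · simp [satGraph, satRel]
    · simp [optF]
  · simp [optF] at h

lemma optF_weight (n m : ℕ) : rdfWeight (optF n m) = 2 * n + 2 := by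
  simp [rdfWeight, Fintype.sum_sum_type, Fintype.sum_prod_type, optF, Fin.sum_univ_four]
  omega

lemma weight_ge (n m : ℕ) (F : Fin m → Finset (Fin n ⊕ Fin n))
    (f : SatVert n m → Finset (Fin 2)) (hf : IsRDF (satGraph n m F) f) :
    2 * n + 2 ≤ rdfWeight f := by
  have hA : ∀ i : Fin n, 2 ≤ ∑ s : Fin 4, (f (Sum.inl (i, s))).card := by
    intro i
    refine rdf_local_s13 _ f hf (fun s : Fin 4 => Sum.inl (i, s)) 2 3 (by decide) ?_ ?_ <;>
    · rintro (⟨i', s⟩ | j | k) h <;> simp [satGraph, satRel] at h ⊢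
      tauto
  have hB : 2 ≤ ∑ t : Fin m ⊕ Fin 2, (f (Sum.inr t)).card := by
    refine rdf_local_s13 _ f hf (fun t : Fin m ⊕ Fin 2 => Sum.inr t) (Sum.inr 0) (Sum.inr 1)
      (by simp) ?_ ?_ <;>
    · rintro (⟨i', s⟩ | j | k) h <;> simp [satGraph, satRel] at h ⊢
  have hC : ∑ _i : Fin n, 2 ≤ ∑ i : Fin n, ∑ s : Fin 4, (f (Sum.inl (i, s))).card :=
    Finset.sum_le_sum fun i _ => hA i
  unfold rdfWeight
  rw [Fintype.sum_sum_type, Fintype.sum_prod_type]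
  simp only [Finset.sum_const, Finset.card_univ, Fintype.card_fin, smul_eq_mul] at hC
  omega

/-- For a 3-SAT formula `F` with `m ≥ 2` clauses over `n` variables,
`γ_{r2}(G_F) = 2n + 2`. -/
theorem satGraph_gammaR2 (n m : ℕ) (hm : 2 ≤ m)
    (F : Fin m → Finset (Fin n ⊕ Fin n)) (hF : ∀ j, (F j).card ≤ 3) :
    gammaR2 (satGraph n m F) = 2 * n + 2 := by
  apply le_antisymm
  · exact Nat.sInf_le ⟨optF n m, optF_isRDF n m F, optF_weight n m⟩
  · refine le_csInf ⟨_, optF n m, optF_isRDF n m F, rfl⟩ ?_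
    rintro w ⟨f, hf, rfl⟩
    exact weight_ge n m F f hf
end

section
/- Let F be a 3-SAT formula with m ≥ 2 clauses over n variables, and let G_F be the graph constructed from F as described. If F has a satisfying truth assignment, then γ_r(G_F) = n + 1. -/
open Finset

/-- The literal vertex of a gadget which is true under the assignment. -/
def litIdx (b : Bool) : Fin 4 := if b then 0 else 1

/-- The weak Roman dominating function attached to an assignment. -/
def satFun {n m : ℕ} (σ : Fin n → Bool) : SatVert n m → ℕ
  | Sum.inl (i, s) => if s = litIdx (σ i) then 1 else 0
  | Sum.inr (Sum.inl _) => 0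
  | Sum.inr (Sum.inr k) => if k = 0 then 1 else 0

section Adjacency

variable {n m : ℕ} {F : Fin m → Finset (Fin n ⊕ Fin n)}

theorem adj_gadget {i : Fin n} {s t : Fin 4} (h : s ≠ t) :
    (satGraph n m F).Adj (Sum.inl (i, s)) (Sum.inl (i, t)) := by
  simp [satGraph, SimpleGraph.fromRel_adj, satRel, h]

theorem adj_clause_ab (j : Fin m) (k : Fin 2) :
    (satGraph n m F).Adj (Sum.inr (Sum.inl j)) (Sum.inr (Sum.inr k)) := by
  simp [satGraph, SimpleGraph.fromRel_adj, satRel]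

theorem adj_ab {k l : Fin 2} (h : k ≠ l) :
    (satGraph n m F).Adj (Sum.inr (Sum.inr k)) (Sum.inr (Sum.inr l)) := by
  simp [satGraph, SimpleGraph.fromRel_adj, satRel, h]

theorem adj_clause_lit {σ : Fin n → Bool} (h : Satisfies σ F) (j : Fin m) :
    ∃ i, (satGraph n m F).Adj (Sum.inr (Sum.inl j)) (Sum.inl (i, litIdx (σ i))) := by
  obtain ⟨l, hl, hs⟩ := h j
  rcases l with i | i
  · exact ⟨i, by simp_all [satGraph, SimpleGraph.fromRel_adj, satRel, litIdx]⟩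
  · exact ⟨i, by simp_all [satGraph, SimpleGraph.fromRel_adj, satRel, litIdx]⟩

/-- A sufficient condition for domination. -/
theorem dominating_of {D : Set (SatVert n m)}
    (h1 : ∀ i, ∃ s, (Sum.inl (i, s) : SatVert n m) ∈ D)
    (h2 : ∀ j, ∃ v ∈ D, (satGraph n m F).Adj (Sum.inr (Sum.inl j)) v)
    (h3 : ∃ y : Fin m ⊕ Fin 2, (Sum.inr y : SatVert n m) ∈ D) :
    IsDominatingSet (satGraph n m F) D := by
  rintro (⟨i, s⟩ | j | k) hu
  · obtain ⟨t, ht⟩ := h1 i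
    refine ⟨_, ht, adj_gadget ?_⟩
    rintro rfl
    exact hu ht
  · exact h2 j
  · obtain ⟨j | l, hy⟩ := h3
    · exact ⟨_, hy, (adj_clause_ab j k).symm⟩
    · refine ⟨_, hy, adj_ab ?_⟩
      rintro rfl
      exact hu hy

theorem satFun_isWRDF {σ : Fin n → Bool} (h : Satisfies σ F) :
    IsWRDF (satGraph n m F) (satFun σ) := by
  constructor
  · rintro (⟨i, s⟩ | j | k) <;> simp only [satFun] <;> (try split_ifs) <;> omega
  · rintro (⟨i, s⟩ | j | k) hu
    · have hs : s ≠ litIdx (σ i) := by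
        rintro rfl
        simp [satFun] at hu
      refine ⟨Sum.inl (i, litIdx (σ i)), adj_gadget hs, by simp [satFun], dominating_of ?_ ?_ ?_⟩
      · intro i'
        by_cases hi : i' = i
        · subst hi
          exact ⟨s, by simp⟩
        · exact ⟨litIdx (σ i'), by simp [hi, satFun]⟩
      · intro j
        exact ⟨_, by simp [satFun], adj_clause_ab j 0⟩
      · exact ⟨Sum.inr 0, by simp [satFun]⟩
    · refine ⟨Sum.inr (Sum.inr 0), adj_clause_ab j 0, by simp [satFun], dominating_of ?_ ?_ ?_⟩
      · intro i
        exact ⟨litIdx (σ i), by simp [satFun]⟩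
      · intro j'
        obtain ⟨i, hi⟩ := adj_clause_lit h j'
        exact ⟨_, by simp [satFun], hi⟩
      · exact ⟨Sum.inl j, by simp⟩
    · have hk : k ≠ 0 := by
        rintro rfl
        simp [satFun] at hu
      refine ⟨Sum.inr (Sum.inr 0), adj_ab hk, by simp [satFun], dominating_of ?_ ?_ ?_⟩
      · intro i
        exact ⟨litIdx (σ i), by simp [satFun]⟩
      · intro j
        exact ⟨_, by simp, adj_clause_ab j k⟩
      · exact ⟨Sum.inr k, by simp⟩

theorem satFun_weight (σ : Fin n → Bool) :
    wrdfWeight (satFun (m := m) σ) = n + 1 := by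
  rw [wrdfWeight, Fintype.sum_sum_type, Fintype.sum_prod_type]
  simp [satFun]

theorem weight_ge_s14 {g : SatVert n m → ℕ} (hg : IsWRDF (satGraph n m F) g) :
    n + 1 ≤ wrdfWeight g := by
  have h1 : ∀ i : Fin n, 1 ≤ ∑ s, g (Sum.inl (i, s)) := by
    intro i
    have : ∃ s, 1 ≤ g (Sum.inl (i, s)) := by
      by_cases h0 : g (Sum.inl (i, 2)) = 0
      · obtain ⟨v, hv, hv1, -⟩ := hg.2 _ h0
        rcases v with ⟨i', s⟩ | j | k
        · have : i' = i := by
            simp only [satGraph, SimpleGraph.fromRel_adj, satRel] at hv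
            rcases hv.2 with h | h <;> simp [h]
          subst this
          exact ⟨s, hv1⟩
        · simp [satGraph, SimpleGraph.fromRel_adj, satRel] at hv
        · simp [satGraph, SimpleGraph.fromRel_adj, satRel] at hv
      · exact ⟨2, by omega⟩
    obtain ⟨s, hs⟩ := this
    exact hs.trans (Finset.single_le_sum (f := fun s => g (Sum.inl (i, s)))
      (fun _ _ => Nat.zero_le _) (Finset.mem_univ s))
  have h2 : 1 ≤ ∑ y : Fin m ⊕ Fin 2, g (Sum.inr y) := by
    have : ∃ y : Fin m ⊕ Fin 2, 1 ≤ g (Sum.inr y) := by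
      by_cases h0 : g (Sum.inr (Sum.inr 0)) = 0
      · obtain ⟨v, hv, hv1, -⟩ := hg.2 _ h0
        rcases v with ⟨i', s⟩ | y
        · simp [satGraph, SimpleGraph.fromRel_adj, satRel] at hv
        · exact ⟨y, hv1⟩
      · exact ⟨Sum.inr 0, by omega⟩
    obtain ⟨y, hy⟩ := this
    exact hy.trans (Finset.single_le_sum (f := fun y => g (Sum.inr y))
      (fun _ _ => Nat.zero_le _) (Finset.mem_univ y))
  have h3 : n ≤ ∑ i : Fin n, ∑ s, g (Sum.inl (i, s)) := by
    calc n = ∑ _i : Fin n, 1 := by simp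
      _ ≤ _ := Finset.sum_le_sum fun i _ => h1 i
  rw [wrdfWeight, Fintype.sum_sum_type, Fintype.sum_prod_type]
  omega

end Adjacency

/-- If a 3-SAT formula `F` with `m ≥ 2` clauses over `n` variables is satisfiable,
then `γ_r(G_F) = n + 1`. -/
theorem satGraph_gammaR_of_satisfiable (n m : ℕ) (hm : 2 ≤ m)
    (F : Fin m → Finset (Fin n ⊕ Fin n)) (hF : ∀ j, (F j).card ≤ 3)
    (hsat : ∃ σ : Fin n → Bool, Satisfies σ F) :
    gammaR (satGraph n m F) = n + 1 := by
  obtain ⟨σ, hσ⟩ := hsat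
  apply le_antisymm
  · exact Nat.sInf_le ⟨satFun σ, satFun_isWRDF hσ, satFun_weight σ⟩
  · refine le_csInf ⟨_, satFun σ, satFun_isWRDF hσ, rfl⟩ ?_
    rintro w ⟨g, hg, rfl⟩
    exact weight_ge_s14 hg
end

section
/- Let F be a 3-SAT formula with m ≥ 2 clauses over n variables, and let G_F be the graph constructed from F as described. If γ_r(G_F) = n + 1, then F has a satisfying truth assignment. -/
open Finset

theorem nbr_gadget {n m : ℕ} {F : Fin m → Finset (Fin n ⊕ Fin n)} {i : Fin n}
    {v : SatVert n m} (h : (satGraph n m F).Adj (Sum.inl (i, 2)) v) :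
    ∃ s, v = Sum.inl (i, s) := by
  rcases v with ⟨i', s⟩ | j | t
  · have : i = i' := by
      simp only [satGraph, SimpleGraph.fromRel_adj, satRel] at h
      rcases h.2 with h | h
      · exact h
      · exact h.symm
    subst this
    exact ⟨s, rfl⟩
  · simp [satGraph, satRel] at h
  · simp [satGraph, satRel] at h

theorem gadget_pos {n m : ℕ} {F : Fin m → Finset (Fin n ⊕ Fin n)} {D : Set (SatVert n m)}
    (hD : IsDominatingSet (satGraph n m F) D) (i : Fin n) : ∃ s, Sum.inl (i, s) ∈ D := by
  by_cases h : (Sum.inl (i, 2) : SatVert n m) ∈ D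
  · exact ⟨2, h⟩
  · obtain ⟨v, hv, ha⟩ := hD _ h
    obtain ⟨s, rfl⟩ := nbr_gadget ha
    exact ⟨s, hv⟩

theorem nbr_clause {n m : ℕ} {F : Fin m → Finset (Fin n ⊕ Fin n)} {j : Fin m}
    {v : SatVert n m} (h : (satGraph n m F).Adj (Sum.inr (Sum.inl j)) v) :
    (∃ i, v = Sum.inl (i, 0) ∧ Sum.inl i ∈ F j) ∨ (∃ i, v = Sum.inl (i, 1) ∧ Sum.inr i ∈ F j)
      ∨ ∃ t, v = Sum.inr (Sum.inr t) := by
  rcases v with ⟨i', s⟩ | k | t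
  · simp only [satGraph, SimpleGraph.fromRel_adj, satRel] at h
    rcases h.2 with h | ⟨rfl, h'⟩ | ⟨rfl, h'⟩
    · exact h.elim
    · exact Or.inl ⟨i', rfl, h'⟩
    · exact Or.inr (Or.inl ⟨i', rfl, h'⟩)
  · simp [satGraph, satRel] at h
  · exact Or.inr (Or.inr ⟨t, rfl⟩)

theorem nbr_ab {n m : ℕ} {F : Fin m → Finset (Fin n ⊕ Fin n)} {t : Fin 2}
    {v : SatVert n m} (h : (satGraph n m F).Adj (Sum.inr (Sum.inr t)) v) :
    ∃ w, v = Sum.inr w := by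
  rcases v with ⟨i', s⟩ | w
  · simp [satGraph, satRel] at h
  · exact ⟨w, rfl⟩

theorem sum_one_unique {α : Type*} [Fintype α] [DecidableEq α] {f : α → ℕ}
    (hf : ∑ x, f x = 1) {x y : α} (hx : 1 ≤ f x) (hy : 1 ≤ f y) : x = y := by
  by_contra hne
  have h := Finset.sum_le_sum_of_subset (f := f) (Finset.subset_univ ({x, y} : Finset α))
  rw [Finset.sum_pair hne] at h
  omega

theorem sum_one_le {α : Type*} [Fintype α] {f : α → ℕ}
    (hf : ∑ x, f x = 1) (x : α) : f x ≤ 1 :=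
  hf ▸ Finset.single_le_sum (f := f) (fun _ _ => Nat.zero_le _) (Finset.mem_univ x)

/-- If `γ_r(G_F) = n + 1` for a 3-SAT formula `F` with `m ≥ 2` clauses over `n`
variables, then `F` is satisfiable. -/
theorem satisfiable_of_satGraph_gammaR (n m : ℕ) (hm : 2 ≤ m)
    (F : Fin m → Finset (Fin n ⊕ Fin n)) (hF : ∀ j, (F j).card ≤ 3)
    (hgr : gammaR (satGraph n m F) = n + 1) :
    ∃ σ : Fin n → Bool, Satisfies σ F := by
  classical
  have hne : {w | ∃ g, IsWRDF (satGraph n m F) g ∧ wrdfWeight g = w}.Nonempty := by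
    apply Nat.nonempty_of_sInf_eq_succ (k := n)
    exact hgr
  have hmem := Nat.sInf_mem hne
  obtain ⟨g, ⟨-, hg⟩, hw⟩ := hmem
  change wrdfWeight g = gammaR (satGraph n m F) at hw
  rw [hgr, wrdfWeight, Fintype.sum_sum_type, Fintype.sum_prod_type] at hw
  have hdom : IsDominatingSet (satGraph n m F) {x | 1 ≤ g x} := by
    intro u hu
    obtain ⟨v, ha, hv, -⟩ := hg u (by simpa using hu)
    exact ⟨v, hv, ha⟩
  have hS : ∀ i ∈ (Finset.univ : Finset (Fin n)), 1 ≤ ∑ s, g (Sum.inl (i, s)) := by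
    intro i _
    obtain ⟨s, hs⟩ := gadget_pos hdom i
    exact le_trans hs (Finset.single_le_sum (f := fun s => g (Sum.inl (i, s)))
      (fun _ _ => Nat.zero_le _) (Finset.mem_univ s))
  have hT : ∃ w, 1 ≤ g (Sum.inr w) := by
    by_cases h : 1 ≤ g (Sum.inr (Sum.inr 0))
    · exact ⟨_, h⟩
    · obtain ⟨v, hv, ha⟩ := hdom (Sum.inr (Sum.inr 0)) h
      obtain ⟨w, rfl⟩ := nbr_ab ha
      exact ⟨w, hv⟩
  obtain ⟨w, hwp⟩ := hT
  have hT1 : 1 ≤ ∑ w, g (Sum.inr w) :=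
    le_trans hwp (Finset.single_le_sum (f := fun w => g (Sum.inr w))
      (fun _ _ => Nat.zero_le _) (Finset.mem_univ w))
  have hSn := Finset.sum_le_sum hS
  have hc : ∑ i : Fin n, 1 = n := by simp
  have hT' : ∑ w, g (Sum.inr w) = 1 := by omega
  have hS' : ∀ i, ∑ s, g (Sum.inl (i, s)) = 1 := by
    have := (Finset.sum_eq_sum_iff_of_le hS).1 (by omega)
    intro i
    exact (this i (Finset.mem_univ i)).symm
  -- literals cannot defend clause vertices
  have hlit : ∀ (k : Fin m) i s, 1 ≤ g (Sum.inl (i, s)) →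
      ¬ IsDominatingSet (satGraph n m F) {x | 1 ≤ (if x = Sum.inr (Sum.inl k) then
        g (Sum.inr (Sum.inl k)) + 1 else if x = Sum.inl (i, s) then
        g (Sum.inl (i, s)) - 1 else g x)} := by
    intro k i s hp hD
    obtain ⟨s', hs'⟩ := gadget_pos hD i
    have h1 := sum_one_le (hS' i) s
    by_cases hss : s' = s
    · subst hss
      simp at hs'
      omega
    · simp [hss] at hs'
      exact hss (sum_one_unique (hS' i) hs' hp)
  have hdef : ∀ k : Fin m, g (Sum.inr (Sum.inl k)) = 0 → ∃ t, w = Sum.inr t ∧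
      IsDominatingSet (satGraph n m F) {x | 1 ≤ (if x = Sum.inr (Sum.inl k) then
        g (Sum.inr (Sum.inl k)) + 1 else if x = Sum.inr (Sum.inr t) then
        g (Sum.inr (Sum.inr t)) - 1 else g x)} := by
    intro k hk
    obtain ⟨v, ha, hv, hD⟩ := hg _ hk
    rcases nbr_clause ha with ⟨i, rfl, -⟩ | ⟨i, rfl, -⟩ | ⟨t, rfl⟩
    · exact (hlit k i 0 hv hD).elim
    · exact (hlit k i 1 hv hD).elim
    · exact ⟨t, sum_one_unique hT' hwp hv, hD⟩
  have hother : ∀ j : Fin m, ∃ k, k ≠ j := by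
    intro j
    have : Nontrivial (Fin m) := Fin.nontrivial_iff_two_le.2 hm
    exact exists_ne j
  have hzero : ∀ w', w' ≠ w → g (Sum.inr w') = 0 := by
    intro w' hne
    by_contra h
    exact hne (sum_one_unique hT' (Nat.one_le_iff_ne_zero.2 h) hwp)
  have hab : ∃ t, w = Sum.inr t := by
    rcases w with j | t
    · obtain ⟨k, hk⟩ := hother j
      obtain ⟨t, ht, -⟩ := hdef k (hzero _ (by simpa using hk))
      cases ht
    · exact ⟨t, rfl⟩
  obtain ⟨t, rfl⟩ := hab
  have hcl : ∀ k : Fin m, g (Sum.inr (Sum.inl k)) = 0 := fun k => hzero _ (by simp)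
  refine ⟨fun i => decide (1 ≤ g (Sum.inl (i, 0))), fun j => ?_⟩
  obtain ⟨k, hk⟩ := hother j
  obtain ⟨t', ht, hD⟩ := hdef k (hcl k)
  obtain rfl : t = t' := by simpa using ht
  obtain ⟨v, hv, ha⟩ := hD (Sum.inr (Sum.inl j)) (by simp [hk.symm, hcl])
  rcases nbr_clause ha with ⟨i, rfl, hi⟩ | ⟨i, rfl, hi⟩ | ⟨t', rfl⟩
  · refine ⟨_, hi, ?_⟩
    simpa using hv
  · refine ⟨_, hi, ?_⟩
    have hv' : 1 ≤ g (Sum.inl (i, 1)) := by simpa using hv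
    simp only [decide_eq_false_iff_not]
    intro h0
    exact absurd (sum_one_unique (hS' i) h0 hv') (by decide)
  · exfalso
    have h1 : g (Sum.inr (Sum.inr t)) ≤ 1 := sum_one_le hT' (Sum.inr t)
    by_cases htt : t' = t
    · subst htt
      simp at hv
      omega
    · simp [htt] at hv
      have := hzero (Sum.inr t') (by simpa using htt)
      omega
end

section
/- Let F be a 3-SAT formula with m clauses over n variables, and let G_F be the graph constructed from F as described. Then G_F contains no clique on five vertices (G_F is K_5-free) and has exactly 4n + m + 2 vertices. -/
open Finset

/-- `G_F` is `K₅`-free and has exactly `4n + m + 2` vertices. -/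
theorem satGraph_K5free_card (n m : ℕ)
    (F : Fin m → Finset (Fin n ⊕ Fin n)) (hF : ∀ j, (F j).card ≤ 3) :
    (satGraph n m F).CliqueFree 5 ∧ Fintype.card (SatVert n m) = 4 * n + m + 2 := by
  constructor
  · -- proper 4-colouring: K₄ vertices by label, clauses get 2, `a`, `b` get 0, 1
    let col : SatVert n m → Fin 4 := fun v => match v with
      | Sum.inl (_, s) => s
      | Sum.inr (Sum.inl _) => 2
      | Sum.inr (Sum.inr t) => Fin.castLE (by omega) t
    have key : ∀ u v, u ≠ v → satRel n m F u v → col u ≠ col v := by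
      rintro (⟨i, s⟩ | j | t) (⟨i', s'⟩ | j' | t') hne h <;> simp only [satRel] at h <;>
        simp only [col]
      · rintro rfl
        exact hne (by rw [h])
      · rcases h with ⟨rfl, _⟩ | ⟨rfl, _⟩ <;> decide
      · revert t'
        intro t' _
        fin_cases t' <;> decide
      · intro hc
        exact hne (by rw [Fin.castLE_injective _ hc])
    have hcol : (satGraph n m F).Colorable 4 := by
      refine ⟨SimpleGraph.Coloring.mk col ?_⟩
      intro u v huv
      rw [satGraph, SimpleGraph.fromRel_adj] at huv
      rcases huv with ⟨hne, h | h⟩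
      · exact key u v hne h
      · exact (key v u hne.symm h).symm
    exact hcol.cliqueFree (by norm_num)
  · simp [SatVert]
    ring
end

section
/- If G is a finite simple graph with γ_{r2}(G) = 2·γ_r(G), g is a weak Roman dominating function of G of minimum weight, and V_1 is the set of vertices x with g(x) = 1, then V_1 is a dominating set of G of size γ_r(G), and in particular the domination number of G is at most γ_r(G). -/
open Finset

/-- The domination number: the minimum size of a dominating set. -/
noncomputable def dominationNumber {V : Type*} [Fintype V] [DecidableEq V]
    (G : SimpleGraph V) : ℕ :=
  sInf {d | ∃ D : Finset V, IsDominatingSet G (D : Set V) ∧ D.card = d}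

/-- If `γ_{r2}(G) = 2 γ_r(G)` and `g` is a minimum weak Roman dominating function,
then `V₁ = {x | g x = 1}` is a dominating set of size `γ_r(G)`; in particular the
domination number of `G` is at most `γ_r(G)`. -/
theorem V1_dominating {V : Type*} [Fintype V] [DecidableEq V]
    (G : SimpleGraph V) (g : V → ℕ)
    (heq : gammaR2 G = 2 * gammaR G)
    (hg : IsWRDF G g) (hmin : wrdfWeight g = gammaR G) :
    IsDominatingSet G {x : V | g x = 1} ∧
    (Finset.univ.filter (fun x : V => g x = 1)).card = gammaR G ∧
    dominationNumber G ≤ gammaR G := by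
  have hle : ∀ x, (if 1 ≤ g x then 1 else 0) ≤ g x := by
    intro x; split_ifs <;> omega
  have h1 : gammaR2 G ≤ ∑ x, 2 * (if 1 ≤ g x then 1 else 0) := by
    apply Nat.sInf_le
    refine ⟨fun x => if 1 ≤ g x then Finset.univ else ∅, ?_, ?_⟩
    · intro u hu c
      have hu0 : g u = 0 := by
        by_contra h
        have h' : 1 ≤ g u := by omega
        simp only [h', if_true] at hu
        exact Finset.univ_nonempty.ne_empty hu
      obtain ⟨v, hv, hgv, -⟩ := hg.2 u hu0
      exact ⟨v, hv, by simp [hgv]⟩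
    · unfold rdfWeight
      apply Finset.sum_congr rfl
      intro x _
      by_cases h : 1 ≤ g x <;> simp [h]
  rw [← Finset.mul_sum, heq, ← hmin] at h1
  unfold wrdfWeight at h1
  have h2 : ∑ x, (if 1 ≤ g x then 1 else 0) = ∑ x, g x :=
    le_antisymm (Finset.sum_le_sum fun x _ => hle x) (by omega)
  have h3 := (Finset.sum_eq_sum_iff_of_le (fun x _ => hle x)).1 h2
  have h4 : ∀ x, g x ≤ 1 := by
    intro x
    have := h3 x (Finset.mem_univ x)
    split_ifs at this <;> omega
  have hdom : IsDominatingSet G {x : V | g x = 1} := by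
    intro u hu
    have hu' : g u ≠ 1 := hu
    have := h4 u
    obtain ⟨v, hv, hgv, -⟩ := hg.2 u (by omega)
    exact ⟨v, le_antisymm (h4 v) hgv, hv⟩
  have hcard : (Finset.univ.filter (fun x : V => g x = 1)).card = gammaR G := by
    rw [← hmin, Finset.card_filter]
    unfold wrdfWeight
    apply Finset.sum_congr rfl
    intro x _
    have := h4 x
    split_ifs <;> omega
  refine ⟨hdom, hcard, ?_⟩
  apply Nat.sInf_le
  refine ⟨_, ?_, hcard⟩
  simpa using hdom
end
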